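/- Hopf lemma on almost complex manifolds: Let G ⊂ ℝ^{2n} be a bounded domain whose boundary is of class C² (i.e. G = {r < 0} for some C² function r defined on a neighborhood of the closure of G with dr ≠ 0 on ∂G), and let J be a smooth almost complex structure on a neighborhood of the closure of G. Then for every J-plurisubharmonic function u on G with u < 0 there exists a constant C > 0 such that |u(p)| ≥ C·dist(p, ∂G) for every p ∈ G. -/

import Mathlib

open Complex Metric Set MeasureTheory Filter Topology Bornology ENNReal

noncomputable section

/-- We identify `ℝ^{2n}` with `ℂⁿ` (with the Euclidean norm). -/
abbrev Cn (n : ℕ) : Type := EuclideanSpace ℂ (Fin n)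

/-- The standard complex structure on `ℂⁿ ≅ ℝ^{2n}`: multiplication by `i`,
viewed as an `ℝ`-linear map. -/
def Jstd (n : ℕ) : Cn n →L[ℝ] Cn n :=
  ContinuousLinearMap.restrictScalars ℝ (Complex.I • ContinuousLinearMap.id ℂ (Cn n))

/-- The standard complex structure on `ℂ ≅ ℝ²`. -/
def JstdC : ℂ →L[ℝ] ℂ :=
  ContinuousLinearMap.restrictScalars ℝ (Complex.I • ContinuousLinearMap.id ℂ ℂ)

/-- `J` is a (smooth) almost complex structure on the set `Ω ⊆ ℂⁿ ≅ ℝ^{2n}`: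
a `C^∞` field of linear automorphisms with `J(x) ∘ J(x) = -Id`. -/
def IsACS {n : ℕ} (Ω : Set (Cn n)) (J : Cn n → Cn n →L[ℝ] Cn n) : Prop :=
  ContDiffOn ℝ (⊤ : ℕ∞) J Ω ∧ ∀ x ∈ Ω, (J x).comp (J x) = -ContinuousLinearMap.id ℝ (Cn n)

/-- The open unit disc `Δ` in `ℂ`. -/
def unitDisc : Set ℂ := Metric.ball 0 1

/-- A map between (subsets of) almost complex spaces is `(J,J')`-holomorphic on `s` if
`df_x ∘ J(x) = J'(f(x)) ∘ df_x` on `s`. -/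
def PseudoHolOn {n m : ℕ} (J : Cn n → Cn n →L[ℝ] Cn n) (J' : Cn m → Cn m →L[ℝ] Cn m)
    (f : Cn n → Cn m) (s : Set (Cn n)) : Prop :=
  ∀ x ∈ s, DifferentiableAt ℝ f x ∧
    (fderiv ℝ f x).comp (J x) = (J' (f x)).comp (fderiv ℝ f x)

/-- A map from an open subset of `ℂ` is `J`-holomorphic on `s` if
`df_ζ ∘ J_st = J(f(ζ)) ∘ df_ζ` on `s`. -/
def JHolOn {n : ℕ} (J : Cn n → Cn n →L[ℝ] Cn n) (f : ℂ → Cn n) (s : Set ℂ) : Prop :=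
  ∀ ζ ∈ s, DifferentiableAt ℝ f ζ ∧
    (fderiv ℝ f ζ).comp JstdC = (J (f ζ)).comp (fderiv ℝ f ζ)

/-- A `J`-holomorphic disc in `D`. -/
def JDisc {n : ℕ} (J : Cn n → Cn n →L[ℝ] Cn n) (D : Set (Cn n)) (f : ℂ → Cn n) : Prop :=
  MapsTo f unitDisc D ∧ JHolOn J f unitDisc

/-- The nonnegative part of an extended real number, as an element of `ℝ≥0∞`. -/
def erealPos (x : EReal) : ℝ≥0∞ := if x = ⊤ then ⊤ else ENNReal.ofReal x.toReal

/-- The integral of an `EReal`-valued function: the (unsigned) integral of the positive part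
minus the integral of the negative part. -/
def erealIntegral {X : Type} [MeasurableSpace X] (μ : Measure X) (g : X → EReal) : EReal :=
  ((∫⁻ x, erealPos (g x) ∂μ : ℝ≥0∞) : EReal) - ((∫⁻ x, erealPos (-(g x)) ∂μ : ℝ≥0∞) : EReal)

/-- `h : ℂ → [-∞,∞)` is subharmonic on `s`: upper semicontinuous and satisfying the
sub-mean-value inequality `h(a) ≤ (2π)⁻¹ ∫₀^{2π} h(a + r e^{iθ}) dθ` whenever the closed disc
of center `a` and radius `r` is contained in `s`. -/
def SubharmonicOnE (h : ℂ → EReal) (s : Set ℂ) : Prop :=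
  UpperSemicontinuousOn h s ∧
  ∀ a : ℂ, ∀ r : ℝ, 0 < r → Metric.closedBall a r ⊆ s →
    h a ≤ (((2 * Real.pi)⁻¹ : ℝ) : EReal) *
      erealIntegral (volume.restrict (Set.Ioc (0 : ℝ) (2 * Real.pi)))
        (fun θ : ℝ => h (a + (r : ℂ) * Complex.exp ((θ : ℂ) * Complex.I)))

/-- `u : Ω → [-∞,∞)` is `J`-plurisubharmonic on `Ω`: upper semicontinuous, and `u ∘ f` is
subharmonic on `Δ` for every `J`-holomorphic disc `f : Δ → Ω`. -/
def JPshOn {n : ℕ} (J : Cn n → Cn n →L[ℝ] Cn n) (Ω : Set (Cn n)) (u : Cn n → EReal) : Prop :=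
  UpperSemicontinuousOn u Ω ∧
  ∀ f : ℂ → Cn n, JDisc J Ω f → SubharmonicOnE (fun ζ => u (f ζ)) unitDisc

/-- Real-valued `J`-plurisubharmonic functions. -/
def JPshOnR {n : ℕ} (J : Cn n → Cn n →L[ℝ] Cn n) (Ω : Set (Cn n)) (u : Cn n → ℝ) : Prop :=
  JPshOn J Ω (fun x => (u x : EReal))

/-- The `1`-form `J*dr : w ↦ dr_x(J(x)w)`. -/
def JStarDr {n : ℕ} (J : Cn n → Cn n →L[ℝ] Cn n) (r : Cn n → ℝ) (x : Cn n) : Cn n →L[ℝ] ℝ :=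
  (fderiv ℝ r x).comp (J x)

/-- The Levi form of a `C²` function `r`:
`L^J_r(p,v) = -d(J*dr)_p(v, J(p)v)` where `dα_p(u,w) = (∂_u α)_p(w) - (∂_w α)_p(u)`. -/
def LeviForm {n : ℕ} (J : Cn n → Cn n →L[ℝ] Cn n) (r : Cn n → ℝ) (p v : Cn n) : ℝ :=
  -((fderiv ℝ (JStarDr J r) p v) (J p v) - (fderiv ℝ (JStarDr J r) p (J p v)) v)

/-- `r` is strictly `J`-plurisubharmonic on `S`: its Levi form is positive definite there. -/
def StrictJPshOn {n : ℕ} (J : Cn n → Cn n →L[ℝ] Cn n) (r : Cn n → ℝ) (S : Set (Cn n)) : Prop :=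
  ∀ p ∈ S, ∀ v : Cn n, v ≠ 0 → 0 < LeviForm J r p v

/-- The Kobayashi–Royden infinitesimal pseudometric of `(D,J)`:
`K(p,v) = inf {α > 0 : ∃ J-holomorphic disc f : Δ → D, f(0) = p, df_0(∂/∂x) = v/α}`. -/
def kobMetric {n : ℕ} (J : Cn n → Cn n →L[ℝ] Cn n) (D : Set (Cn n)) (p v : Cn n) : ℝ :=
  sInf {α : ℝ | 0 < α ∧ ∃ f : ℂ → Cn n, JDisc J D f ∧ f 0 = p ∧ fderiv ℝ f 0 1 = α⁻¹ • v}

/-- A piecewise `C¹` path `γ : [0,1] → ℝ^{2n}`. -/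
def PiecewiseC1On {n : ℕ} (γ : ℝ → Cn n) : Prop :=
  ContinuousOn γ (Set.Icc 0 1) ∧
  ∃ (m : ℕ) (t : ℕ → ℝ), t 0 = 0 ∧ t m = 1 ∧ (∀ i < m, t i < t (i + 1)) ∧
    ∀ i < m, ContDiffOn ℝ 1 γ (Set.Icc (t i) (t (i + 1)))

/-- The (integrated) Kobayashi pseudodistance of `(D,J)`: the infimum of the Kobayashi–Royden
lengths of piecewise `C¹` paths in `D` joining `p` to `q`. -/
def kobDist {n : ℕ} (J : Cn n → Cn n →L[ℝ] Cn n) (D : Set (Cn n)) (p q : Cn n) : ℝ :=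
  sInf {L : ℝ | ∃ γ : ℝ → Cn n, PiecewiseC1On γ ∧ MapsTo γ (Set.Icc 0 1) D ∧
    γ 0 = p ∧ γ 1 = q ∧ L = ∫ t in (0 : ℝ)..1, kobMetric J D (γ t) (deriv γ t)}

/-- The cluster set of `f` (defined on `S`) along `A ⊆ closure S`: all limits of sequences
`f(s_k)` where `s_k ∈ S` converges to a point of `A`. -/
def clusterSet {X Y : Type*} [TopologicalSpace X] [TopologicalSpace Y]
    (f : X → Y) (S A : Set X) : Set Y :=
  {y | ∃ u : ℕ → X, (∀ k, u k ∈ S) ∧ (∃ a ∈ A, Tendsto u atTop (𝓝 a)) ∧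
    Tendsto (fun k => f (u k)) atTop (𝓝 y)}

/-- `N` is a `d`-dimensional `C^∞` submanifold of `ℂⁿ ≅ ℝ^{2n}`: near every point it can be
straightened, by a `C^∞` diffeomorphism onto an open subset of `ℝ^{2n}`, to the coordinate
subspace spanned by the first `d` coordinates. -/
def IsSmoothSubmanifold {n : ℕ} (d : ℕ) (N : Set (Cn n)) : Prop :=
  ∀ p ∈ N, ∃ (U : Set (Cn n)) (V : Set (EuclideanSpace ℝ (Fin (2 * n))))
    (φ : Cn n → EuclideanSpace ℝ (Fin (2 * n))) (ψ : EuclideanSpace ℝ (Fin (2 * n)) → Cn n),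
    IsOpen U ∧ p ∈ U ∧ IsOpen V ∧ ContDiffOn ℝ (⊤ : ℕ∞) φ U ∧ ContDiffOn ℝ (⊤ : ℕ∞) ψ V ∧
    (∀ x ∈ U, ψ (φ x) = x) ∧ (∀ y ∈ V, φ (ψ y) = y) ∧ MapsTo φ U V ∧
    φ '' (N ∩ U) = V ∩ {x | ∀ i : Fin (2 * n), d ≤ (i : ℕ) → x i = 0}

/-- The tangent set of `N ⊆ ℂⁿ` at `p`: velocities at `0` of differentiable curves through `p`
staying in `N` near time `0`. For a `C^∞` submanifold this is the tangent space `T_pN`. -/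
def TangentSet {n : ℕ} (N : Set (Cn n)) (p : Cn n) : Set (Cn n) :=
  {v | ∃ γ : ℝ → Cn n, γ 0 = p ∧ (∀ᶠ t in 𝓝 (0 : ℝ), γ t ∈ N) ∧
    DifferentiableAt ℝ γ 0 ∧ deriv γ 0 = v}

/-- `N` is totally real for `J`: `T_pN ∩ J(p)(T_pN) = {0}` at every `p ∈ N`. -/
def TotallyReal {n : ℕ} (J : Cn n → Cn n →L[ℝ] Cn n) (N : Set (Cn n)) : Prop :=
  ∀ p ∈ N, ∀ v ∈ TangentSet N p, J p v ∈ TangentSet N p → v = 0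

/-- `ρ` is a (global) `C^∞` defining function of `D`, defined on the neighborhood `Ω` of the
closure of `D`, with nonvanishing differential on `∂D`.  (This encodes that `D` has
`C^∞` boundary.) -/
def DefiningFunction {n : ℕ} (D Ω : Set (Cn n)) (ρ : Cn n → ℝ) : Prop :=
  IsOpen Ω ∧ closure D ⊆ Ω ∧ ContDiffOn ℝ (⊤ : ℕ∞) ρ Ω ∧
  D = {x ∈ Ω | ρ x < 0} ∧ ∀ x ∈ frontier D, fderiv ℝ ρ x ≠ 0

/-- `D` is a bounded strictly `J`-pseudoconvex domain with `C^∞` boundary: it admits a smooth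
defining function which is `J`-plurisubharmonic on `D` and strictly `J`-plurisubharmonic on a
neighborhood of `∂D`. -/
def StrictlyPseudoconvexDomain {n : ℕ} (J : Cn n → Cn n →L[ℝ] Cn n) (D : Set (Cn n)) : Prop :=
  IsOpen D ∧ IsConnected D ∧ IsBounded D ∧
  ∃ (Ω : Set (Cn n)) (ρ : Cn n → ℝ), DefiningFunction D Ω ρ ∧
    JPshOnR J D ρ ∧ ∃ W : Set (Cn n), IsOpen W ∧ frontier D ⊆ W ∧ StrictJPshOn J ρ W

end

open scoped NNReal

namespace Hopf

noncomputable local instance instMSC : MeasureSpace UnitAddCircle := ⟨AddCircle.haarAddCircle⟩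
local instance instHaarC : Measure.IsAddHaarMeasure (volume : Measure UnitAddCircle) :=
  inferInstanceAs (Measure.IsAddHaarMeasure AddCircle.haarAddCircle)
local instance instProbC : IsProbabilityMeasure (volume : Measure UnitAddCircle) :=
  inferInstanceAs (IsProbabilityMeasure AddCircle.haarAddCircle)

/-- the two-dimensional torus -/
abbrev Tor : Type := UnitAddTorus (Fin 2)
/-- frequencies -/
abbrev Fq : Type := Fin 2 → ℤ
/-- continuous functions on the torus -/
abbrev CT : Type := C(Tor, ℂ)

/-- characters -/
noncomputable abbrev ee (k : Fq) : CT := UnitAddTorus.mFourier k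

lemma ee_add (k m : Fq) : ee (k + m) = ee k * ee m := by
  ext x; exact UnitAddTorus.mFourier_add

lemma ee_zero : ee 0 = 1 := UnitAddTorus.mFourier_zero

lemma norm_ee_apply (k : Fq) (x : Tor) : ‖ee k x‖ = 1 := by
  simp only [UnitAddTorus.mFourier, fourier_apply, ContinuousMap.coe_mk, norm_prod, Circle.norm_coe,
      Finset.prod_const_one]

lemma ee_apply_add (k : Fq) (x h : Tor) : ee k (x + h) = ee k x * ee k h := by
  simp only [UnitAddTorus.mFourier, fourier_apply, ContinuousMap.coe_mk, Pi.add_apply, smul_add,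
    AddCircle.toCircle_add, Circle.coe_mul, Finset.prod_mul_distrib]

/-- Fourier coefficient -/
noncomputable def cf (f : CT) (k : Fq) : ℂ := UnitAddTorus.mFourierCoeff f k

lemma cf_def (f : CT) (k : Fq) : cf f k = ∫ t : Tor, ee (-k) t * f t := rfl

lemma integ (f : CT) : Integrable (fun t : Tor => f t) := by
  exact (f.continuous.integrable_of_hasCompactSupport (HasCompactSupport.of_compactSpace _))

lemma cf_add (f g : CT) (k : Fq) : cf (f + g) k = cf f k + cf g k := by
  simp only [cf_def, ContinuousMap.add_apply, mul_add]
  exact integral_add (integ (ee (-k) * f)) (integ (ee (-k) * g))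

lemma cf_smul (c : ℂ) (f : CT) (k : Fq) : cf (c • f) k = c * cf f k := by
  simp only [cf_def, ContinuousMap.smul_apply, smul_eq_mul, ← integral_const_mul]
  congr 1; ext t; ring

lemma norm_cf_le (f : CT) (k : Fq) : ‖cf f k‖ ≤ ‖f‖ := by
  rw [cf_def]
  have := norm_integral_le_of_norm_le_const (μ := (volume : Measure Tor))
    (f := fun t => ee (-k) t * f t) (C := ‖f‖) (Eventually.of_forall fun t => by
      rw [norm_mul, norm_ee_apply, one_mul]; exact f.norm_coe_le_norm t)
  simpa using this

/-- Fourier coefficient as a continuous linear map -/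
noncomputable def cfL (k : Fq) : CT →L[ℂ] ℂ :=
  LinearMap.mkContinuous ⟨⟨fun f => cf f k, fun f g => cf_add f g k⟩, fun c f => cf_smul c f k⟩ 1
    (fun f => by simpa using norm_cf_le f k)

@[simp] lemma cfL_apply (k : Fq) (f : CT) : cfL k f = cf f k := rfl

lemma cf_sub (f g : CT) (k : Fq) : cf (f - g) k = cf f k - cf g k := map_sub (cfL k) f g
lemma cf_zero (k : Fq) : cf 0 k = 0 := map_zero (cfL k)

lemma cf_ee_mul (f : CT) (k m : Fq) : cf (ee m * f) k = cf f (k - m) := by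
  simp only [cf_def, ContinuousMap.mul_apply]
  congr 1; ext t
  rw [show -(k - m) = -k + m by abel, ee_add, ContinuousMap.mul_apply, mul_assoc]

/-- translation -/
noncomputable def tr (h : Tor) (f : CT) : CT := ⟨fun x => f (x + h), by fun_prop⟩

@[simp] lemma tr_apply (h : Tor) (f : CT) (x : Tor) : tr h f x = f (x + h) := rfl

lemma cf_tr (h : Tor) (f : CT) (k : Fq) : cf (tr h f) k = ee k h * cf f k := by
  simp only [cf_def, tr_apply]
  rw [← integral_const_mul, ← integral_add_right_eq_self (fun t : Tor => ee k h * (ee (-k) t * f t)) h]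
  congr 1; ext t
  rw [ee_apply_add, show ee k h * (ee (-k) t * ee (-k) h * f (t + h))
    = (ee k * ee (-k)) h * (ee (-k) t * f (t+h)) by simp only [ContinuousMap.mul_apply]; ring, ← ee_add]
  simp [ee_zero]

lemma cf_star (f : CT) (k : Fq) : cf (star f) k = star (cf f (-k)) := by
  simp only [cf_def, ContinuousMap.star_apply, neg_neg]
  rw [show (star (∫ t : Tor, ee k t * f t) : ℂ) = (starRingEnd ℂ) (∫ t : Tor, ee k t * f t) from rfl,
    ← integral_conj]
  congr 1; ext t
  rw [map_mul, ← UnitAddTorus.mFourier_neg]; rfl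

lemma cf_one (k : Fq) : cf 1 k = if k = 0 then 1 else 0 := by
  have := orthonormal_iff_ite.mp (UnitAddTorus.orthonormal_mFourier (d := Fin 2)) k 0
  rw [ContinuousMap.inner_toLp] at this
  rw [← this, cf_def]
  congr 1; ext t
  rw [← UnitAddTorus.mFourier_neg, ContinuousMap.one_apply]
  rw [UnitAddTorus.mFourier_zero]; simp

lemma cf_ee (k m : Fq) : cf (ee m) k = if k = m then 1 else 0 := by
  have := cf_ee_mul 1 k m
  rw [mul_one, cf_one] at this
  rw [this]; simp [sub_eq_zero]

lemma bessel (f : CT) (S : Finset Fq) : ∑ k ∈ S, ‖cf f k‖ ^ 2 ≤ ‖f‖ ^ 2 := by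
  have h := UnitAddTorus.hasSum_sq_mFourierCoeff (ContinuousMap.toLp 2 volume ℂ f)
  simp only [UnitAddTorus.mFourierCoeff_toLp] at h
  refine (h.summable.sum_le_tsum S (fun _ _ => by positivity)).trans ?_
  rw [h.tsum_eq]
  have h2 : ∫ t : Tor, ‖(ContinuousMap.toLp 2 volume ℂ f) t‖ ^ 2 = ∫ t : Tor, ‖f t‖ ^ 2 := by
    refine integral_congr_ae ?_
    filter_upwards [ContinuousMap.coeFn_toLp (p := 2) (𝕜 := ℂ) volume f] with t ht
    rw [ht]
  rw [h2]
  have := norm_integral_le_of_norm_le_const (μ := (volume : Measure Tor))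
    (f := fun t => ‖f t‖ ^ 2) (C := ‖f‖ ^ 2) (Eventually.of_forall fun t => by
      rw [Real.norm_of_nonneg (by positivity)]; gcongr; exact f.norm_coe_le_norm t)
  have h3 := (le_abs_self _).trans this
  simpa using h3

lemma hasSum_of_summable (f : CT) (h : Summable (cf f)) :
    HasSum (fun k => cf f k • ee k) f :=
  UnitAddTorus.hasSum_mFourier_series_of_summable h

end Hopf

namespace Hopf

/-- weight -/
noncomputable def wt (k : Fq) : ℝ≥0 := 1 + ‖k 0‖₊ + ‖k 1‖₊

lemma one_le_wt (k : Fq) : 1 ≤ wt k := by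
  unfold wt; rw [add_assoc]; exact le_self_add

lemma wt_add (k m : Fq) : wt (k + m) ≤ wt k * wt m := by
  unfold wt
  simp only [Pi.add_apply]
  calc 1 + ‖k 0 + m 0‖₊ + ‖k 1 + m 1‖₊ ≤ 1 + (‖k 0‖₊ + ‖m 0‖₊) + (‖k 1‖₊ + ‖m 1‖₊) := by
        gcongr <;> exact nnnorm_add_le _ _
    _ ≤ (1 + ‖k 0‖₊ + ‖k 1‖₊) * (1 + ‖m 0‖₊ + ‖m 1‖₊) := by
        rw [← NNReal.coe_le_coe]; push_cast
        nlinarith [norm_nonneg (k 0), norm_nonneg (k 1), norm_nonneg (m 0), norm_nonneg (m 1),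
          mul_nonneg (norm_nonneg (k 0)) (norm_nonneg (m 0)), mul_nonneg (norm_nonneg (k 0)) (norm_nonneg (m 1)),
          mul_nonneg (norm_nonneg (k 1)) (norm_nonneg (m 0)), mul_nonneg (norm_nonneg (k 1)) (norm_nonneg (m 1))]

lemma wt_neg (k : Fq) : wt (-k) = wt k := by simp [wt]
lemma wt_zero : wt 0 = 1 := by simp [wt]

/-- weighted Wiener norm -/
noncomputable def N (s : ℕ) (f : CT) : ℝ≥0∞ := ∑' k, (((wt k) ^ s : ℝ≥0) : ℝ≥0∞) * ‖cf f k‖ₑ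

lemma N_mono {s s' : ℕ} (h : s ≤ s') (f : CT) : N s f ≤ N s' f := by
  unfold N
  gcongr with k
  exact one_le_wt k

lemma N_add (s : ℕ) (f g : CT) : N s (f + g) ≤ N s f + N s g := by
  unfold N
  rw [← ENNReal.tsum_add]
  gcongr with k
  rw [← mul_add, cf_add]
  gcongr
  exact enorm_add_le _ _

lemma N_sub (s : ℕ) (f g : CT) : N s (f - g) ≤ N s f + N s g := by
  unfold N
  rw [← ENNReal.tsum_add]
  gcongr with k
  rw [← mul_add, cf_sub]
  gcongr
  exact enorm_sub_le

lemma N_smul (s : ℕ) (c : ℂ) (f : CT) : N s (c • f) = ‖c‖ₑ * N s f := by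
  unfold N
  rw [← ENNReal.tsum_mul_left]
  congr 1; ext k
  rw [cf_smul, enorm_mul]; ring

lemma N_zero (s : ℕ) : N s 0 = 0 := by simp [N, cf_zero]

lemma N_sum (s : ℕ) {ι : Type*} (S : Finset ι) (f : ι → CT) : N s (∑ i ∈ S, f i) ≤ ∑ i ∈ S, N s (f i) := by
  classical
  induction S using Finset.induction_on with
  | empty => simp [N_zero]
  | insert a S ha ih => rw [Finset.sum_insert ha, Finset.sum_insert ha]; exact (N_add s _ _).trans (by gcongr)

lemma summable_of_N {s : ℕ} {f : CT} (h : N s f ≠ ⊤) : Summable (cf f) := by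
  have h0 : N 0 f ≠ ⊤ := ne_top_of_le_ne_top h (N_mono (Nat.zero_le s) f)
  unfold N at h0
  simp only [pow_zero, ENNReal.coe_one, one_mul] at h0
  have h1 : Summable (fun k => ‖cf f k‖₊) := ENNReal.tsum_coe_ne_top_iff_summable.mp h0
  refine Summable.of_norm ?_
  have h2 := NNReal.summable_coe.mpr h1
  exact h2.congr fun k => by simp

lemma enorm_le_N (f : CT) : ‖f‖ₑ ≤ N 0 f := by
  by_cases h : N 0 f = ⊤
  · rw [h]; exact le_top
  have hs := hasSum_of_summable f (summable_of_N h)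
  conv_lhs => rw [← hs.tsum_eq]
  refine (enorm_tsum_le_tsum_enorm (f := fun k => cf f k • ee k)).trans ?_
  unfold N
  gcongr with k
  rw [pow_zero, ENNReal.coe_one, one_mul, enorm_smul, ← enorm_norm (ee k), UnitAddTorus.mFourier_norm]
  simp

lemma cf_mul {f : CT} (hf : Summable (cf f)) (g : CT) (k : Fq) :
    HasSum (fun m => cf f m * cf g (k - m)) (cf (f * g) k) := by
  have hs := hasSum_of_summable f hf
  have h2 := (cfL k).hasSum (hs.mul_right g)
  simp only [cfL_apply] at h2
  refine h2.congr_fun fun m => ?_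
  rw [smul_mul_assoc, cf_smul, cf_ee_mul]

lemma N_mul {s : ℕ} {f : CT} (hf : N s f ≠ ⊤) (g : CT) : N s (f * g) ≤ N s f * N s g := by
  have hs := summable_of_N hf
  calc N s (f * g) ≤ ∑' k, (((wt k) ^ s : ℝ≥0) : ℝ≥0∞) * ∑' m, ‖cf f m‖ₑ * ‖cf g (k - m)‖ₑ := by
        unfold N
        gcongr with k
        rw [← (cf_mul hs g k).tsum_eq]
        refine (enorm_tsum_le_tsum_enorm).trans ?_
        simp [enorm_mul]
    _ ≤ ∑' k, ∑' m, ((((wt m) ^ s : ℝ≥0) : ℝ≥0∞) * ‖cf f m‖ₑ) * ((((wt (k - m)) ^ s : ℝ≥0) : ℝ≥0∞) * ‖cf g (k - m)‖ₑ) := by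
        gcongr with k
        rw [← ENNReal.tsum_mul_left]
        refine ENNReal.tsum_le_tsum fun m => ?_
        have : wt k ^ s ≤ wt m ^ s * wt (k - m) ^ s := by
          rw [← mul_pow]; gcongr
          have := wt_add m (k - m); simpa using this
        calc _ ≤ ((wt m ^ s * wt (k - m) ^ s : ℝ≥0) : ℝ≥0∞) * (‖cf f m‖ₑ * ‖cf g (k - m)‖ₑ) := by gcongr
          _ = _ := by push_cast; ring
    _ = N s f * N s g := by
        rw [ENNReal.tsum_comm]
        unfold N
        rw [← ENNReal.tsum_mul_right]
        congr 1; ext m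
        rw [ENNReal.tsum_mul_left]
        congr 1
        exact (Equiv.subRight m).tsum_eq (fun k => (((wt k) ^ s : ℝ≥0) : ℝ≥0∞) * ‖cf g k‖ₑ)

lemma N_star (s : ℕ) (f : CT) : N s (star f) = N s f := by
  unfold N
  rw [← (Equiv.neg Fq).tsum_eq]
  congr 1; ext k
  simp only [Equiv.neg_apply, wt_neg, cf_star, neg_neg]
  congr 1
  rw [← enorm_norm, norm_star, enorm_norm]

/-- real part -/
noncomputable def reC (f : CT) : CT := ⟨fun x => ((f x).re : ℂ), by fun_prop⟩

@[simp] lemma reC_apply (f : CT) (x : Tor) : reC f x = ((f x).re : ℂ) := rfl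

lemma reC_eq (f : CT) : reC f = (1 / 2 : ℂ) • (f + star f) := by
  ext x
  simp only [reC_apply, ContinuousMap.smul_apply, ContinuousMap.add_apply, ContinuousMap.star_apply, smul_eq_mul]
  have := Complex.add_conj (f x)
  rw [show star (f x) = (starRingEnd ℂ) (f x) from rfl, this]; push_cast; ring

lemma N_reC (s : ℕ) (f : CT) : N s (reC f) ≤ N s f := by
  rw [reC_eq, N_smul]
  calc _ ≤ ‖(1/2 : ℂ)‖ₑ * (N s f + N s f) := by gcongr; exact (N_add _ _ _).trans (by rw [N_star])
    _ = N s f := by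
      rw [← two_mul, ← mul_assoc]
      have : ‖(1/2 : ℂ)‖ₑ * 2 = 1 := by
        rw [← ofReal_norm, ← ENNReal.ofReal_ofNat, ← ENNReal.ofReal_mul (by positivity)]; norm_num
      rw [this, one_mul]

lemma N_ee (s : ℕ) (k : Fq) : N s (ee k) = ((wt k ^ s : ℝ≥0) : ℝ≥0∞) := by
  unfold N
  rw [tsum_eq_single k]
  · simp [cf_ee]
  · intro m hm; simp [cf_ee, hm]

lemma N_one (s : ℕ) : N s 1 = 1 := by
  rw [← ee_zero, N_ee, wt_zero]; simp

lemma N_const (s : ℕ) (c : ℂ) : N s (ContinuousMap.const Tor c) = ‖c‖ₑ := by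
  rw [show ContinuousMap.const Tor c = c • (1 : CT) by ext; simp, N_smul, N_one, mul_one]

/-- small translations -/
def hh (j : Fin 2) (t : ℝ) : Tor := Pi.single j (t : UnitAddCircle)

lemma ee_hh (k : Fq) (j : Fin 2) (t : ℝ) : ee k (hh j t) = Complex.exp ((2 * Real.pi * (k j) * t : ℝ) * I) := by
  unfold hh
  simp only [UnitAddTorus.mFourier, ContinuousMap.coe_mk]
  rw [Finset.prod_eq_single j]
  · rw [Pi.single_eq_same, fourier_coe_apply]; congr 1; push_cast; ring
  · intro b _ hb; rw [Pi.single_eq_of_ne hb]; simp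
  · simp

lemma hh_neg (j : Fin 2) (t : ℝ) : hh j (-t) = - hh j t := by
  unfold hh; ext i; by_cases h : i = j
  · subst h; simp
  · simp [h]

lemma abs_le_wt (k : Fq) (j : Fin 2) : |(k j : ℝ)| ≤ wt k := by
  have h0 := norm_nonneg (k 0); have h1 := norm_nonneg (k 1)
  unfold wt; push_cast
  fin_cases j
  · simp only [Int.norm_eq_abs] at *; simp; linarith
  · simp only [Int.norm_eq_abs] at *; simp; linarith

lemma N_tr_sub (s : ℕ) (f : CT) (j : Fin 2) (t : ℝ) :
    N s (tr (hh j t) f - f) ≤ ENNReal.ofReal (2 * Real.pi * |t|) * N (s + 1) f := by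
  unfold N
  rw [← ENNReal.tsum_mul_left]
  refine ENNReal.tsum_le_tsum fun k => ?_
  rw [cf_sub, cf_tr, show ee k (hh j t) * cf f k - cf f k = (ee k (hh j t) - 1) * cf f k by ring, enorm_mul]
  have h : ‖ee k (hh j t) - 1‖ₑ ≤ ENNReal.ofReal (2 * Real.pi * |t|) * (wt k : ℝ≥0∞) := by
    rw [ee_hh, ← ofReal_norm, ← ENNReal.ofReal_coe_nnreal (p := wt k), ← ENNReal.ofReal_mul (by positivity)]
    apply ENNReal.ofReal_le_ofReal
    rw [mul_comm]
    refine (Real.norm_exp_I_mul_ofReal_sub_one_le).trans ?_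
    rw [Real.norm_eq_abs, abs_mul, abs_mul, abs_of_pos (by positivity : (0:ℝ) < 2 * Real.pi)]
    have := abs_le_wt k j
    have h0 : 0 ≤ 2 * Real.pi * |t| := by positivity
    nlinarith
  calc _ ≤ (((wt k) ^ s : ℝ≥0) : ℝ≥0∞) * ((ENNReal.ofReal (2 * Real.pi * |t|) * (wt k : ℝ≥0∞)) * ‖cf f k‖ₑ) := by gcongr
    _ = _ := by push_cast; ring

lemma N_tr2 (f : CT) (j : Fin 2) (t : ℝ) :
    N 0 (tr (hh j t) f + tr (hh j (-t)) f - (2 : ℂ) • f) ≤ ENNReal.ofReal ((2 * Real.pi * |t|) ^ 2) * N 2 f := by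
  have e' : tr (hh j t) f + tr (hh j (-t)) f - (2 : ℂ) • f =
      tr (hh j (-t)) (tr (hh j t) (tr (hh j t) f - f) - (tr (hh j t) f - f)) := by
    ext x
    simp only [ContinuousMap.add_apply, ContinuousMap.sub_apply, ContinuousMap.smul_apply, tr_apply,
      hh_neg, smul_eq_mul, neg_add_cancel_right]
    ring
  have ntr : ∀ g h, N 0 (tr h g) = N 0 g := by
    intro g h
    unfold N; congr 1; ext k
    rw [cf_tr, enorm_mul, ← enorm_norm (ee k h), norm_ee_apply]; simp
  rw [e', ntr]
  refine (N_tr_sub 0 _ j t).trans ?_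
  calc _ ≤ ENNReal.ofReal (2 * Real.pi * |t|) * (ENNReal.ofReal (2 * Real.pi * |t|) * N 2 f) := by
        gcongr; exact N_tr_sub 1 f j t
    _ = _ := by rw [← mul_assoc, ← ENNReal.ofReal_mul (by positivity), sq]

end Hopf

namespace Hopf

lemma exists_small_t (S : Finset Fq) : ∃ t : ℝ, 0 < t ∧ ∀ k ∈ S, ∀ j, |(k j : ℝ)| * t ≤ 1 / 2 := by
  refine ⟨1 / (2 * (1 + ∑ k ∈ S, (wt k : ℝ))), by positivity, fun k hk j => ?_⟩
  have h1 : (wt k : ℝ) ≤ ∑ k ∈ S, (wt k : ℝ) :=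
    Finset.single_le_sum (f := fun k => (wt k : ℝ)) (fun _ _ => NNReal.coe_nonneg _) hk
  have h2 := abs_le_wt k j
  have h0 : 0 ≤ ∑ k ∈ S, (wt k : ℝ) := Finset.sum_nonneg fun _ _ => NNReal.coe_nonneg _
  rw [mul_one_div, div_le_div_iff₀ (by positivity) (by positivity)]
  linarith

lemma norm_ee_sub_one_ge (k : Fq) (j : Fin 2) (t : ℝ) (ht : 0 < t) (h : |(k j : ℝ)| * t ≤ 1 / 2) :
    4 * |(k j : ℝ)| * t ≤ ‖ee k (hh j t) - 1‖ := by
  rw [ee_hh, mul_comm (_ : ℂ) I, Complex.norm_exp_I_mul_ofReal_sub_one, norm_mul]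
  have hx : |2 * Real.pi * (k j) * t / 2| = Real.pi * (|(k j : ℝ)| * t) := by
    rw [show 2 * Real.pi * (k j) * t / 2 = Real.pi * ((k j) * t) by ring, abs_mul, abs_mul,
      abs_of_pos Real.pi_pos, abs_of_pos ht]
  have := Real.mul_abs_le_abs_sin (x := 2 * Real.pi * (k j) * t / 2) (by
    rw [hx]; nlinarith [Real.pi_pos])
  rw [hx] at this
  have e : 2 / Real.pi * (Real.pi * (|(k j : ℝ)| * t)) = 2 * (|(k j : ℝ)| * t) := by
    field_simp
  rw [e] at this
  simp only [Real.norm_eq_abs]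
  norm_num
  linarith

lemma norm_ee_second_ge (k : Fq) (j : Fin 2) (t : ℝ) (ht : 0 < t) (h : |(k j : ℝ)| * t ≤ 1 / 2) :
    (k j : ℝ) ^ 2 * t ^ 2 ≤ ‖ee k (hh j t) + ee k (hh j (-t)) - 2‖ := by
  have h1 := norm_ee_sub_one_ge k j t ht h
  have hm : ee k (hh j t) * ee k (hh j (-t)) = 1 := by
    rw [← ee_apply_add, hh_neg, add_neg_cancel]
    simp [UnitAddTorus.mFourier]
  have e : (ee k (hh j t) + ee k (hh j (-t)) - 2) = ee k (hh j (-t)) * (ee k (hh j t) - 1) ^ 2 := by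
    linear_combination (-ee k (hh j t) + 2) * hm
  rw [e, norm_mul, norm_ee_apply, one_mul, norm_pow]
  have h0 : 0 ≤ |(k j : ℝ)| * t := by positivity
  have : (|(k j : ℝ)| * t) ^ 2 ≤ ‖ee k (hh j t) - 1‖ ^ 2 := by
    gcongr; linarith
  rwa [mul_pow, sq_abs] at this

lemma NS_of_first_diff (s : ℕ) (f : CT) (C0 C : ℝ≥0∞) (h0 : N s f ≤ C0)
    (h : ∀ j, ∀ t : ℝ, 0 < t → N s (tr (hh j t) f - f) ≤ ENNReal.ofReal t * C) :
    N (s + 1) f ≤ C0 + C + C := by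
  have key : ∀ j, ∑' k : Fq, (‖k j‖₊ : ℝ≥0∞) * (((wt k ^ s : ℝ≥0) : ℝ≥0∞) * ‖cf f k‖ₑ) ≤ C := by
    intro j
    rw [ENNReal.tsum_eq_iSup_sum]
    refine iSup_le fun S => ?_
    obtain ⟨t, ht, hS⟩ := exists_small_t S
    have h1 := h j t ht
    have h2 : ENNReal.ofReal t * ∑ k ∈ S, (‖k j‖₊ : ℝ≥0∞) * (((wt k ^ s : ℝ≥0) : ℝ≥0∞) * ‖cf f k‖ₑ)
        ≤ N s (tr (hh j t) f - f) := by
      unfold N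
      refine le_trans ?_ (ENNReal.sum_le_tsum S)
      rw [Finset.mul_sum]
      refine Finset.sum_le_sum fun k hk => ?_
      rw [cf_sub, cf_tr, show ee k (hh j t) * cf f k - cf f k = (ee k (hh j t) - 1) * cf f k by ring,
        enorm_mul]
      rw [show ENNReal.ofReal t * ((‖k j‖₊ : ℝ≥0∞) * (((wt k ^ s : ℝ≥0) : ℝ≥0∞) * ‖cf f k‖ₑ)) =
        ((wt k ^ s : ℝ≥0) : ℝ≥0∞) * ((ENNReal.ofReal t * (‖k j‖₊ : ℝ≥0∞)) * ‖cf f k‖ₑ) by ring]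
      gcongr
      have := norm_ee_sub_one_ge k j t ht (hS k hk j)
      rw [← ENNReal.ofReal_coe_nnreal, ← ENNReal.ofReal_mul ht.le, ← ofReal_norm]
      apply ENNReal.ofReal_le_ofReal
      refine le_trans ?_ this
      simp only [coe_nnnorm, Int.norm_eq_abs]
      nlinarith [abs_nonneg (k j : ℝ), mul_nonneg (abs_nonneg (k j : ℝ)) ht.le]
    have h3 := h2.trans h1
    exact (ENNReal.mul_le_mul_iff_right (by simpa using ht) ENNReal.ofReal_ne_top).mp h3
  have e : N (s + 1) f = N s f + ∑' k : Fq, (‖k 0‖₊ : ℝ≥0∞) * (((wt k ^ s : ℝ≥0) : ℝ≥0∞) * ‖cf f k‖ₑ)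
      + ∑' k : Fq, (‖k 1‖₊ : ℝ≥0∞) * (((wt k ^ s : ℝ≥0) : ℝ≥0∞) * ‖cf f k‖ₑ) := by
    unfold N
    rw [← ENNReal.tsum_add, ← ENNReal.tsum_add]
    congr 1; ext k
    rw [pow_succ]; nth_rw 2 [wt]; push_cast; ring
  rw [e]
  gcongr
  · exact key 0
  · exact key 1

/-- universal constant -/
noncomputable def KK : ℝ := ∑' x : Fq, ‖x‖ ^ (-(4 : ℝ))

lemma N0_of_second_diff (f : CT) (C : ℝ) (h0 : ‖f‖ ≤ C)
    (h : ∀ j, ∀ t : ℝ, 0 < t → ‖tr (hh j t) f + tr (hh j (-t)) f - (2 : ℂ) • f‖ ≤ C * t ^ 2) :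
    N 0 f ≤ ENNReal.ofReal (C + 2 * C ^ 2 + KK) := by
  have hC : 0 ≤ C := (norm_nonneg _).trans h0
  have key : ∀ (j : Fin 2) (S : Finset Fq), ∑ k ∈ S, (k j : ℝ) ^ 4 * ‖cf f k‖ ^ 2 ≤ C ^ 2 := by
    intro j S
    obtain ⟨t, ht, hS⟩ := exists_small_t S
    have h1 := bessel (tr (hh j t) f + tr (hh j (-t)) f - (2 : ℂ) • f) S
    have h2 : t ^ 4 * ∑ k ∈ S, (k j : ℝ) ^ 4 * ‖cf f k‖ ^ 2 ≤ t ^ 4 * C ^ 2 := by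
      calc _ ≤ ∑ k ∈ S, ‖cf (tr (hh j t) f + tr (hh j (-t)) f - (2 : ℂ) • f) k‖ ^ 2 := by
            rw [Finset.mul_sum]
            refine Finset.sum_le_sum fun k hk => ?_
            rw [cf_sub, cf_add, cf_tr, cf_tr, cf_smul, show ee k (hh j t) * cf f k + ee k (hh j (-t)) * cf f k - 2 * cf f k
              = (ee k (hh j t) + ee k (hh j (-t)) - 2) * cf f k by ring, norm_mul, mul_pow]
            rw [← mul_assoc]
            gcongr
            have := norm_ee_second_ge k j t ht (hS k hk j)
            calc t ^ 4 * (k j : ℝ) ^ 4 = ((k j : ℝ) ^ 2 * t ^ 2) ^ 2 := by ring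
              _ ≤ _ := by gcongr
        _ ≤ _ := h1
        _ ≤ (C * t ^ 2) ^ 2 := by gcongr; exact h j t ht
        _ = _ := by ring
    exact le_of_mul_le_mul_left h2 (by positivity)
  unfold N
  rw [ENNReal.tsum_eq_iSup_sum]
  refine iSup_le fun S => ?_
  have hsum := EisensteinSeries.summable_one_div_norm_rpow (k := 4) (by norm_num)
  have hpt : ∀ k : Fq, ‖cf f k‖ ≤ (if k = 0 then C else 0) + ((k 0 : ℝ) ^ 4 * ‖cf f k‖ ^ 2 +
      (k 1 : ℝ) ^ 4 * ‖cf f k‖ ^ 2) + ‖k‖ ^ (-(4 : ℝ)) := by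
    intro k
    by_cases hk : k = 0
    · simp only [hk, if_true]
      have := (norm_cf_le f 0).trans h0
      have h4 : (0 : ℝ) ≤ ‖(0 : Fq)‖ ^ (-(4 : ℝ)) := by positivity
      have : 0 ≤ (((0 : Fq) 0 : ℤ) : ℝ) ^ 4 * ‖cf f 0‖ ^ 2 + (((0 : Fq) 1 : ℤ) : ℝ) ^ 4 * ‖cf f 0‖ ^ 2 := by positivity
      linarith
    · simp only [hk, if_false, zero_add]
      have hpos : 0 < ‖k‖ := norm_pos_iff.mpr hk
      have hn : ‖k‖ ^ 4 ≤ (k 0 : ℝ) ^ 4 + (k 1 : ℝ) ^ 4 := by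
        obtain ⟨j, hj⟩ : ∃ j, ‖k‖ = ‖k j‖ := by
          obtain ⟨j, -, hj⟩ := Finset.exists_mem_eq_sup' (Finset.univ_nonempty (α := Fin 2)) (fun j => ‖k j‖)
          refine ⟨j, le_antisymm ?_ (norm_le_pi_norm k j)⟩
          rw [pi_norm_le_iff_of_nonneg (norm_nonneg _), ← hj]
          intro i; exact Finset.le_sup' (fun j => ‖k j‖) (Finset.mem_univ i)
        rw [hj, Int.norm_eq_abs, Even.pow_abs (by decide)]
        have a0 : 0 ≤ (k 0 : ℝ) ^ 4 := by positivity
        have a1 : 0 ≤ (k 1 : ℝ) ^ 4 := by positivity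
        fin_cases j
        · simp; linarith
        · simp; linarith
      have e1 : ‖k‖ ^ (-(4 : ℝ)) = (‖k‖ ^ 2)⁻¹ ^ 2 := by
        rw [Real.rpow_neg hpos.le, show (4 : ℝ) = ((4 : ℕ) : ℝ) by norm_num, Real.rpow_natCast, inv_pow, ← pow_mul]
      rw [e1, ← add_mul]
      have e2 : ‖cf f k‖ = (‖k‖ ^ 2 * ‖cf f k‖) * (‖k‖ ^ 2)⁻¹ := by field_simp
      have e3 : ‖cf f k‖ ≤ (‖k‖ ^ 2 * ‖cf f k‖) ^ 2 + (‖k‖ ^ 2)⁻¹ ^ 2 := by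
        nth_rewrite 1 [e2]
        nlinarith [sq_nonneg ((‖k‖ ^ 2 * ‖cf f k‖) - (‖k‖ ^ 2)⁻¹), sq_nonneg ((‖k‖ ^ 2 * ‖cf f k‖) + (‖k‖ ^ 2)⁻¹)]
      have e4 : (‖k‖ ^ 2 * ‖cf f k‖) ^ 2 ≤ ((k 0 : ℝ) ^ 4 + (k 1 : ℝ) ^ 4) * ‖cf f k‖ ^ 2 := by
        rw [mul_pow, ← pow_mul]; gcongr
      linarith
  have hreal : ∑ k ∈ S, ‖cf f k‖ ≤ C + 2 * C ^ 2 + KK := by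
    refine (Finset.sum_le_sum fun k _ => hpt k).trans ?_
    rw [Finset.sum_add_distrib, Finset.sum_add_distrib, Finset.sum_add_distrib]
    have a1 : ∑ k ∈ S, (if k = (0 : Fq) then C else 0) ≤ C := by
      rw [Finset.sum_ite_eq']; split_ifs <;> linarith
    have a2 := key 0 S
    have a3 := key 1 S
    have a4 : ∑ k ∈ S, ‖k‖ ^ (-(4 : ℝ)) ≤ KK := hsum.sum_le_tsum S (fun _ _ => by positivity)
    linarith
  calc _ = ENNReal.ofReal (∑ k ∈ S, ‖cf f k‖) := by
        rw [ENNReal.ofReal_sum_of_nonneg (fun _ _ => norm_nonneg _)]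
        refine Finset.sum_congr rfl fun k _ => ?_
        rw [ofReal_norm]; simp
    _ ≤ _ := ENNReal.ofReal_le_ofReal hreal

end Hopf

namespace Hopf

lemma taylor2 {E F : Type*} [NormedAddCommGroup E] [NormedSpace ℝ E] [NormedAddCommGroup F]
    [NormedSpace ℝ F] (f : E → F) (hf : Differentiable ℝ f) (K : ℝ) (hK0 : 0 ≤ K)
    (hK : ∀ x y, ‖fderiv ℝ f x - fderiv ℝ f y‖ ≤ K * ‖x - y‖) (x y : E) :
    ‖f y - f x - fderiv ℝ f x (y - x)‖ ≤ K * ‖y - x‖ ^ 2 := by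
  have := (convex_closedBall x ‖y - x‖).norm_image_sub_le_of_norm_fderiv_le' (𝕜 := ℝ) (f := f)
    (φ := fderiv ℝ f x) (C := K * ‖y - x‖) (x := x) (y := y) (fun z _ => hf z) (fun z hz => by
      refine (hK z x).trans ?_
      rw [mem_closedBall, dist_eq_norm] at hz
      gcongr) (by simp) (by simp [dist_eq_norm])
  rw [sq, ← mul_assoc]; exact this

/-- smooth compactly supported functions -/
def SS (d : ℕ) : Type := {F : (Fin d → ℝ) → ℝ // ContDiff ℝ (⊤ : ℕ∞) F ∧ HasCompactSupport F}

/-- partial derivative -/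
noncomputable def SS.pd {d : ℕ} (F : SS d) (l : Fin d) : SS d :=
  ⟨fun x => fderiv ℝ F.1 x (Pi.single l 1), by
    have h : ContDiff ℝ (⊤ : ℕ∞) (fderiv ℝ F.1) := F.2.1.fderiv_right (by simp)
    exact h.clm_apply contDiff_const, by
    have h : HasCompactSupport (fderiv ℝ F.1) := F.2.2.fderiv ℝ
    exact h.comp_left (g := fun L : (Fin d → ℝ) →L[ℝ] ℝ => L (Pi.single l 1)) (by simp)⟩

lemma SS.fderiv_eq {d : ℕ} (F : SS d) (x v : Fin d → ℝ) :
    fderiv ℝ F.1 x v = ∑ l, (F.pd l).1 x * v l := by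
  have : v = ∑ l, v l • (Pi.single l (1 : ℝ) : Fin d → ℝ) := by
    ext i; simp [Finset.sum_apply, Pi.single_apply]
  conv_lhs => rw [this]
  simp [SS.pd, mul_comm]

lemma SS.bd {d : ℕ} (F : SS d) : ∃ C : ℝ, 0 ≤ C ∧ (∀ a, |F.1 a| ≤ C) ∧
    (∀ a b, |F.1 a - F.1 b| ≤ C * ‖a - b‖) ∧
    (∀ a b, |F.1 b - F.1 a - fderiv ℝ F.1 a (b - a)| ≤ C * ‖b - a‖ ^ 2) := by
  obtain ⟨C1, h1⟩ := F.2.2.exists_bound_of_continuous F.2.1.continuous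
  obtain ⟨C2, h2⟩ := F.2.1.lipschitzWith_of_hasCompactSupport F.2.2 (by simp)
  obtain ⟨C3, h3⟩ := (F.2.1.fderiv_right (m := (⊤ : ℕ∞)) (by simp)).lipschitzWith_of_hasCompactSupport
    (F.2.2.fderiv ℝ) (by simp)
  have h10 : 0 ≤ C1 := (norm_nonneg _).trans (h1 0)
  refine ⟨C1 + C2 + C3, by positivity, fun a => ?_, fun a b => ?_, fun a b => ?_⟩
  · have := h1 a; rw [Real.norm_eq_abs] at this
    have h2 := C2.2; have h3 := C3.2
    simp only [NNReal.val_eq_coe] at *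
    linarith
  · have := h2.dist_le_mul a b
    rw [dist_eq_norm, dist_eq_norm, Real.norm_eq_abs] at this
    refine this.trans ?_
    gcongr
    have h3 := C3.2
    simp only [NNReal.val_eq_coe] at *
    linarith
  · have := taylor2 F.1 (F.2.1.differentiable (by simp)) C3 C3.2 (fun x y => by
      have := h3.dist_le_mul x y
      rwa [dist_eq_norm, dist_eq_norm] at this) a b
    rw [Real.norm_eq_abs] at this
    refine this.trans ?_
    gcongr
    have h3 := C2.2
    simp only [NNReal.val_eq_coe] at *
    linarith

/-- vector of real parts -/
noncomputable def rv {d : ℕ} (G : Fin d → CT) (x : Tor) : Fin d → ℝ := fun l => (G l x).re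

lemma rv_cont {d : ℕ} (G : Fin d → CT) : Continuous (rv G) := by
  unfold rv; fun_prop

/-- composition -/
noncomputable def cmp {d : ℕ} (F : SS d) (G : Fin d → CT) : CT :=
  ⟨fun x => (F.1 (rv G x) : ℂ), by
    have := F.2.1.continuous.comp (rv_cont G)
    exact Complex.continuous_ofReal.comp this⟩

lemma cmp_apply {d : ℕ} (F : SS d) (G : Fin d → CT) (x : Tor) : cmp F G x = (F.1 (rv G x) : ℂ) := rfl

lemma tr_cmp {d : ℕ} (F : SS d) (G : Fin d → CT) (h : Tor) : tr h (cmp F G) = cmp F (fun l => tr h (G l)) := rfl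

lemma norm_le_of_N {f : CT} {R : ℝ} (hR : 0 ≤ R) (h : N 0 f ≤ ENNReal.ofReal R) : ‖f‖ ≤ R := by
  have := (enorm_le_N f).trans h
  rwa [← ofReal_norm, ENNReal.ofReal_le_ofReal_iff hR] at this

lemma norm_rv_sub {d : ℕ} (G G' : Fin d → CT) (R : ℝ) (hR : 0 ≤ R) (h : ∀ l, ‖G l - G' l‖ ≤ R) (x : Tor) :
    ‖rv G x - rv G' x‖ ≤ R := by
  rw [pi_norm_le_iff_of_nonneg hR]
  intro l
  refine le_trans ?_ (h l)
  refine le_trans ?_ ((G l - G' l).norm_coe_le_norm x)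
  simpa [rv] using Complex.abs_re_le_norm (G l x - G' l x)

lemma B0 {d : ℕ} (F : SS d) (R : ℝ) (hR : 0 ≤ R) : ∃ C : ℝ, 0 ≤ C ∧ ∀ G : Fin d → CT,
    (∀ l, N 2 (G l) ≤ ENNReal.ofReal R) → N 0 (cmp F G) ≤ ENNReal.ofReal C := by
  obtain ⟨C, hC0, hb, hl, ht⟩ := F.bd
  set P := (2 * Real.pi) ^ 2 with hP
  set C' := C + C * (2 * (P * R ^ 2) + P * R) with hC'
  have hKK : 0 ≤ KK := tsum_nonneg fun _ => by positivity
  have hP0 : 0 ≤ P := by positivity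
  refine ⟨C' + 2 * C' ^ 2 + KK, by positivity, fun G hG => ?_⟩
  refine N0_of_second_diff _ _ ?_ ?_
  · rw [ContinuousMap.norm_le _ (by positivity)]
    intro x
    rw [cmp_apply, Complex.norm_real, Real.norm_eq_abs]
    refine (hb _).trans ?_
    have : 0 ≤ C * (2 * (P * R ^ 2) + P * R) := by positivity
    linarith
  · intro j t ht0
    have d1 : ∀ (t : ℝ) l, ‖tr (hh j t) (G l) - G l‖ ≤ 2 * Real.pi * |t| * R := by
      intro t l
      refine norm_le_of_N (by positivity) ?_
      refine (N_tr_sub 0 (G l) j t).trans ?_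
      rw [ENNReal.ofReal_mul (p := 2 * Real.pi * |t|) (by positivity)]
      exact mul_le_mul_right ((N_mono (s := 0 + 1) (s' := 2) (by norm_num) _).trans (hG l)) _
    have d2 : ∀ l, ‖tr (hh j t) (G l) + tr (hh j (-t)) (G l) - (2 : ℂ) • G l‖ ≤ (2 * Real.pi * |t|) ^ 2 * R := by
      intro l
      refine norm_le_of_N (by positivity) ?_
      refine (N_tr2 (G l) j t).trans ?_
      rw [ENNReal.ofReal_mul (by positivity)]
      gcongr
      exact hG l
    rw [ContinuousMap.norm_le _ (by positivity)]
    intro x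
    rw [tr_cmp, tr_cmp]
    set a := rv (fun l => tr (hh j t) (G l)) x
    set c := rv (fun l => tr (hh j (-t)) (G l)) x
    set b := rv G x
    have e1 : ‖a - b‖ ≤ 2 * Real.pi * |t| * R :=
      norm_rv_sub (fun l => tr (hh j t) (G l)) G _ (by positivity) (d1 t) x
    have e2 : ‖c - b‖ ≤ 2 * Real.pi * |t| * R := by
      have := norm_rv_sub (fun l => tr (hh j (-t)) (G l)) G _ (by positivity) (d1 (-t)) x
      rwa [abs_neg] at this
    have e3 : ‖(a - b) + (c - b)‖ ≤ (2 * Real.pi * |t|) ^ 2 * R := by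
      have := norm_rv_sub (fun l => tr (hh j t) (G l) + tr (hh j (-t)) (G l)) (fun l => (2 : ℂ) • G l)
        _ (by positivity) d2 x
      refine le_of_eq_of_le ?_ this
      congr 1
      ext l
      simp [a, b, c, rv]
      ring
    have : (cmp F (fun l => tr (hh j t) (G l)) + cmp F (fun l => tr (hh j (-t)) (G l)) - (2 : ℂ) • cmp F G) x
      = ((F.1 a + F.1 c - 2 * F.1 b : ℝ) : ℂ) := by
      simp [cmp_apply, a, b, c]
    rw [this, Complex.norm_real, Real.norm_eq_abs]
    have t1 := ht b a
    have t2 := ht b c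
    have t3 : |fderiv ℝ F.1 b ((a - b) + (c - b))| ≤ C * ‖(a - b) + (c - b)‖ := by
      rw [← Real.norm_eq_abs]
      refine ContinuousLinearMap.le_of_opNorm_le _ ?_ _
      refine norm_fderiv_le_of_lipschitz ℝ (C := ⟨C, hC0⟩) ?_
      refine LipschitzWith.of_dist_le_mul fun x y => ?_
      rw [dist_eq_norm, dist_eq_norm]; exact hl x y
    rw [map_add] at t3
    have q1 : ‖a - b‖ ^ 2 ≤ (2 * Real.pi * |t| * R) ^ 2 := by gcongr
    have q2 : ‖c - b‖ ^ 2 ≤ (2 * Real.pi * |t| * R) ^ 2 := by gcongr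
    have q1' := mul_le_mul_of_nonneg_left q1 hC0
    have q2' := mul_le_mul_of_nonneg_left q2 hC0
    have q3' := mul_le_mul_of_nonneg_left e3 hC0
    have hsq : |t| ^ 2 = t ^ 2 := sq_abs t
    have e : F.1 a + F.1 c - 2 * F.1 b = (F.1 a - F.1 b - fderiv ℝ F.1 b (a - b)) +
      (F.1 c - F.1 b - fderiv ℝ F.1 b (c - b)) + (fderiv ℝ F.1 b (a - b) + fderiv ℝ F.1 b (c - b)) := by ring
    rw [e]
    refine (abs_add_three _ _ _).trans ?_
    calc _ ≤ C * (2 * Real.pi * |t| * R) ^ 2 + C * (2 * Real.pi * |t| * R) ^ 2 + C * ((2 * Real.pi * |t|) ^ 2 * R) := by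
          linarith
      _ = C * (2 * (P * R ^ 2) + P * R) * t ^ 2 := by rw [hP, ← hsq]; ring
      _ ≤ C' * t ^ 2 := by
          gcongr; rw [hC']; linarith

/-- the path of compositions is differentiable -/
lemma cmp_hasDerivAt {d : ℕ} (F : SS d) (G δ : Fin d → CT) (τ : ℝ) :
    HasDerivAt (fun τ : ℝ => cmp F (fun l => G l + (τ : ℂ) • δ l))
      (∑ l, cmp (F.pd l) (fun l => G l + (τ : ℂ) • δ l) * reC (δ l)) τ := by
  obtain ⟨C, hC0, -, -, ht⟩ := F.bd
  set D := ∑ l, ‖δ l‖ with hD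
  have hD0 : 0 ≤ D := Finset.sum_nonneg fun _ _ => norm_nonneg _
  rw [hasDerivAt_iff_isLittleO]
  have hO : (fun x' : ℝ => cmp F (fun l => G l + (x' : ℂ) • δ l) - cmp F (fun l => G l + (τ : ℂ) • δ l) -
      (x' - τ) • ∑ l, cmp (F.pd l) (fun l => G l + (τ : ℂ) • δ l) * reC (δ l)) =O[𝓝 τ] fun x' => (x' - τ) ^ 2 := by
    refine Asymptotics.IsBigO.of_bound (C * D ^ 2) (Eventually.of_forall fun x' => ?_)
    rw [ContinuousMap.norm_le _ (by positivity)]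
    intro x
    set a := rv (fun l => G l + (τ : ℂ) • δ l) x
    set b := rv (fun l => G l + (x' : ℂ) • δ l) x
    have hba : b - a = (x' - τ) • (rv δ x) := by
      ext l; simp [a, b, rv]; ring
    have := ht a b
    rw [hba] at this
    have hn : ‖(x' - τ) • rv δ x‖ ≤ ‖x' - τ‖ * D := by
      rw [norm_smul]
      gcongr
      rw [pi_norm_le_iff_of_nonneg hD0]
      intro l
      refine le_trans ?_ (Finset.single_le_sum (f := fun l => ‖δ l‖) (fun _ _ => norm_nonneg _) (Finset.mem_univ l))
      exact (Complex.abs_re_le_norm (δ l x)).trans ((δ l).norm_coe_le_norm x)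
    have e : (cmp F (fun l => G l + (x' : ℂ) • δ l) - cmp F (fun l => G l + (τ : ℂ) • δ l) -
      (x' - τ) • ∑ l, cmp (F.pd l) (fun l => G l + (τ : ℂ) • δ l) * reC (δ l)) x =
      ((F.1 b - F.1 a - fderiv ℝ F.1 a ((x' - τ) • rv δ x) : ℝ) : ℂ) := by
      rw [map_smul, SS.fderiv_eq]
      simp only [ContinuousMap.sub_apply, ContinuousMap.smul_apply, ContinuousMap.sum_apply, ContinuousMap.mul_apply,
        cmp_apply, reC_apply]
      simp [a, b, rv]
    rw [e, Complex.norm_real, Real.norm_eq_abs, norm_pow]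
    refine this.trans ?_
    calc _ ≤ C * (‖x' - τ‖ * D) ^ 2 := by gcongr
      _ = _ := by ring
  refine hO.trans_isLittleO ?_
  have : (fun x' : ℝ => (x' - τ) ^ 2) =o[𝓝 τ] fun x' => (x' - τ) ^ 1 := by
    have h := (Asymptotics.isLittleO_pow_pow (𝕜 := ℝ) (m := 1) (n := 2) (by norm_num))
    have ht : Tendsto (fun x' : ℝ => x' - τ) (𝓝 τ) (𝓝 0) := by
      have : Tendsto (fun x' : ℝ => x' - τ) (𝓝 τ) (𝓝 (τ - τ)) := tendsto_id.sub_const τ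
      rwa [sub_self] at this
    exact h.comp_tendsto ht
  simpa using this

lemma N_le_of_dual (s : ℕ) (f : CT) (C : ℝ≥0∞)
    (h : ∀ (S : Finset Fq) (α : Fq → ℂ), (∀ k, ‖α k‖ ≤ 1) →
      ‖∑ k ∈ S, (((wt k : ℝ) ^ s : ℝ) : ℂ) * α k * cf f k‖ₑ ≤ C) : N s f ≤ C := by
  unfold N
  rw [ENNReal.tsum_eq_iSup_sum]
  refine iSup_le fun S => ?_
  refine le_trans (le_of_eq ?_) (h S (fun k => star (cf f k) / ‖cf f k‖) (fun k => by
    rw [norm_div, norm_star, Complex.norm_real, norm_norm]; exact div_self_le_one _))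
  have : ∀ k, (((wt k : ℝ) ^ s : ℝ) : ℂ) * (star (cf f k) / ‖cf f k‖) * cf f k = (((wt k : ℝ) ^ s * ‖cf f k‖ : ℝ) : ℂ) := by
    intro k
    by_cases h0 : cf f k = 0
    · simp [h0]
    have h1 : (‖cf f k‖ : ℂ) ≠ 0 := by simpa using h0
    have h2 : star (cf f k) * cf f k = (‖cf f k‖ : ℂ) ^ 2 := by
      have := Complex.conj_mul' (cf f k)
      simpa using this
    field_simp
    push_cast
    linear_combination ((wt k : ℝ) ^ s : ℂ) * h2
  simp_rw [this]
  rw [← Complex.ofReal_sum, ← ofReal_norm, Complex.norm_real, Real.norm_of_nonneg (Finset.sum_nonneg fun _ _ => by positivity),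
    ENNReal.ofReal_sum_of_nonneg (fun _ _ => by positivity)]
  refine Finset.sum_congr rfl fun k _ => ?_
  rw [ENNReal.ofReal_mul (by positivity), ofReal_norm]
  congr 1
  rw [← NNReal.coe_pow, ENNReal.ofReal_coe_nnreal]

lemma dual_le_N (s : ℕ) (f : CT) (S : Finset Fq) (α : Fq → ℂ) (hα : ∀ k, ‖α k‖ ≤ 1) :
      ‖∑ k ∈ S, (((wt k : ℝ) ^ s : ℝ) : ℂ) * α k * cf f k‖ₑ ≤ N s f := by
  refine (enorm_sum_le _ _).trans ?_
  refine le_trans ?_ (ENNReal.sum_le_tsum S)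
  refine Finset.sum_le_sum fun k _ => ?_
  rw [enorm_mul, enorm_mul]
  gcongr
  have h1 : ‖(((wt k : ℝ) ^ s : ℝ) : ℂ)‖ₑ = ((wt k ^ s : ℝ≥0) : ℝ≥0∞) := by
    rw [← ofReal_norm, Complex.norm_real, Real.norm_of_nonneg (by positivity), ← NNReal.coe_pow, ENNReal.ofReal_coe_nnreal]
  rw [h1]
  have h2 : ‖α k‖ₑ ≤ 1 := by
    rw [← ofReal_norm]; exact ENNReal.ofReal_le_one.mpr (hα k)
  calc _ ≤ ((wt k ^ s : ℝ≥0) : ℝ≥0∞) * 1 := by gcongr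
    _ = _ := mul_one _

lemma Lip {d : ℕ} (F : SS d) (s : ℕ) (C : ℝ) (G1 G2 : Fin d → CT)
    (h : ∀ l, ∀ τ ∈ Icc (0 : ℝ) 1, N s (cmp (F.pd l) (fun l => G2 l + (τ : ℂ) • (G1 l - G2 l))) ≤ ENNReal.ofReal C) :
    N s (cmp F G1 - cmp F G2) ≤ ENNReal.ofReal C * ∑ l, N s (G1 l - G2 l) := by
  by_cases htop : ENNReal.ofReal C * ∑ l, N s (G1 l - G2 l) = ⊤
  · rw [htop]; exact le_top
  refine N_le_of_dual _ _ _ fun S α hα => ?_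
  set Λ : CT →L[ℝ] ℂ := ∑ k ∈ S, ((((wt k : ℝ) ^ s : ℝ) : ℂ) * α k) • (cfL k).restrictScalars ℝ with hΛ
  have hΛa : ∀ f, Λ f = ∑ k ∈ S, (((wt k : ℝ) ^ s : ℝ) : ℂ) * α k * cf f k := by
    intro f; simp [hΛ, cfL_apply]
  have hd : ∀ τ : ℝ, HasDerivAt (fun τ : ℝ => Λ (cmp F (fun l => G2 l + (τ : ℂ) • (G1 l - G2 l))))
      (Λ (∑ l, cmp (F.pd l) (fun l => G2 l + (τ : ℂ) • (G1 l - G2 l)) * reC (G1 l - G2 l))) τ := fun τ =>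
    Λ.hasFDerivAt.comp_hasDerivAt τ (cmp_hasDerivAt F G2 (fun l => G1 l - G2 l) τ)
  have hb : ∀ τ ∈ Ico (0 : ℝ) 1, ‖Λ (∑ l, cmp (F.pd l) (fun l => G2 l + (τ : ℂ) • (G1 l - G2 l)) * reC (G1 l - G2 l))‖ ≤
      (ENNReal.ofReal C * ∑ l, N s (G1 l - G2 l)).toReal := by
    intro τ hτ
    rw [← toReal_enorm]
    refine ENNReal.toReal_mono htop ?_
    rw [hΛa]
    refine (dual_le_N s _ S α hα).trans ?_
    refine (N_sum _ _ _).trans ?_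
    rw [Finset.mul_sum]
    refine Finset.sum_le_sum fun l _ => ?_
    have hl := h l τ ⟨hτ.1, hτ.2.le⟩
    refine (N_mul (ne_top_of_le_ne_top ENNReal.ofReal_ne_top hl) _).trans ?_
    gcongr
    exact N_reC _ _
  have := norm_image_sub_le_of_norm_deriv_le_segment_01' (fun τ _ => (hd τ).hasDerivWithinAt) hb
  have e1 : (fun l => G2 l + ((1 : ℝ) : ℂ) • (G1 l - G2 l)) = G1 := by ext l : 1; simp
  have e0 : (fun l => G2 l + ((0 : ℝ) : ℂ) • (G1 l - G2 l)) = G2 := by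
    ext l : 1
    ext x
    simp
  simp only [e1, e0] at this
  rw [← map_sub, hΛa] at this
  rw [← ofReal_norm]
  exact ENNReal.ofReal_le_of_le_toReal this

lemma N_seg (s : ℕ) (f g : CT) (R : ℝ) (hf : N s f ≤ ENNReal.ofReal R)
    (hg : N s g ≤ ENNReal.ofReal R) (τ : ℝ) (hτ : τ ∈ Icc (0 : ℝ) 1) :
    N s (g + (τ : ℂ) • (f - g)) ≤ ENNReal.ofReal R := by
  have : g + (τ : ℂ) • (f - g) = ((1 - τ : ℝ) : ℂ) • g + (τ : ℂ) • f := by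
    ext x; simp; ring
  rw [this]
  refine (N_add _ _ _).trans ?_
  rw [N_smul, N_smul, ← ofReal_norm, ← ofReal_norm, Complex.norm_real, Complex.norm_real,
    Real.norm_of_nonneg hτ.1, Real.norm_of_nonneg (by linarith [hτ.2])]
  calc _ ≤ ENNReal.ofReal (1 - τ) * ENNReal.ofReal R + ENNReal.ofReal τ * ENNReal.ofReal R := by gcongr
    _ = ENNReal.ofReal R := by
      rw [← add_mul, ← ENNReal.ofReal_add (by linarith [hτ.2]) hτ.1]; simp

lemma N_tr (s : ℕ) (f : CT) (h : Tor) : N s (tr h f) = N s f := by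
  unfold N
  congr 1; ext k
  rw [cf_tr, enorm_mul, ← ofReal_norm, norm_ee_apply]; simp

lemma exists_common {d : ℕ} (P : Fin d → ℝ → Prop) (hP : ∀ l, ∃ C, 0 ≤ C ∧ P l C)
    (hm : ∀ l C C', C ≤ C' → P l C → P l C') : ∃ C, 0 ≤ C ∧ ∀ l, P l C := by
  choose C h0 hC using hP
  refine ⟨∑ l, C l, Finset.sum_nonneg fun l _ => h0 l, fun l => hm l _ _ ?_ (hC l)⟩
  exact Finset.single_le_sum (fun l _ => h0 l) (Finset.mem_univ l)

lemma Bstep {d : ℕ} (s : ℕ) (hs : s ≤ 1) (R : ℝ) (hR : 0 ≤ R)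
    (H : ∀ F : SS d, ∃ C : ℝ, 0 ≤ C ∧ ∀ G : Fin d → CT,
      (∀ l, N 2 (G l) ≤ ENNReal.ofReal R) → N s (cmp F G) ≤ ENNReal.ofReal C)
    (F : SS d) : ∃ C : ℝ, 0 ≤ C ∧ ∀ G : Fin d → CT,
    (∀ l, N 2 (G l) ≤ ENNReal.ofReal R) → N (s + 1) (cmp F G) ≤ ENNReal.ofReal C := by
  obtain ⟨C0, hC0, h0⟩ := H F
  obtain ⟨C1, hC1, h1⟩ := exists_common (fun l C => ∀ G : Fin d → CT,
    (∀ l, N 2 (G l) ≤ ENNReal.ofReal R) → N s (cmp (F.pd l) G) ≤ ENNReal.ofReal C)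
    (fun l => H (F.pd l)) (fun l C C' h H G hG => (H G hG).trans (by gcongr))
  set D := C1 * (d * (2 * Real.pi * R)) with hD
  refine ⟨C0 + D + D, by positivity, fun G hG => ?_⟩
  have := NS_of_first_diff s (cmp F G) (ENNReal.ofReal C0) (ENNReal.ofReal D) (h0 G hG) (fun j t ht => ?_)
  · rwa [← ENNReal.ofReal_add hC0 (by positivity), ← ENNReal.ofReal_add (by positivity) (by positivity)] at this
  · rw [tr_cmp]
    refine (Lip F s C1 _ _ (fun l τ hτ => h1 l _ fun m => N_seg _ _ _ _ ?_ (hG m) τ hτ)).trans ?_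
    · rw [N_tr]; exact hG m
    · calc _ ≤ ENNReal.ofReal C1 * ∑ l : Fin d, ENNReal.ofReal (2 * Real.pi * |t|) * ENNReal.ofReal R := by
            gcongr with l
            refine (N_tr_sub s (G l) j t).trans ?_
            gcongr
            exact (N_mono (by omega) _).trans (hG l)
        _ = _ := by
          rw [Finset.sum_const, Finset.card_univ, Fintype.card_fin, nsmul_eq_mul, hD, abs_of_pos ht,
            ENNReal.ofReal_mul (p := C1) hC1, ENNReal.ofReal_mul (p := (d : ℝ)) (by positivity), ENNReal.ofReal_natCast,
            ENNReal.ofReal_mul (p := 2 * Real.pi) (by positivity), ENNReal.ofReal_mul (p := 2 * Real.pi) (by positivity)]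
          ring

lemma B1 {d : ℕ} (F : SS d) (R : ℝ) (hR : 0 ≤ R) : ∃ C : ℝ, 0 ≤ C ∧ ∀ G : Fin d → CT,
    (∀ l, N 2 (G l) ≤ ENNReal.ofReal R) → N 1 (cmp F G) ≤ ENNReal.ofReal C :=
  Bstep 0 (by norm_num) R hR (fun F => B0 F R hR) F

lemma B2 {d : ℕ} (F : SS d) (R : ℝ) (hR : 0 ≤ R) : ∃ C : ℝ, 0 ≤ C ∧ ∀ G : Fin d → CT,
    (∀ l, N 2 (G l) ≤ ENNReal.ofReal R) → N 2 (cmp F G) ≤ ENNReal.ofReal C :=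
  Bstep 1 (by norm_num) R hR (fun F => B1 F R hR) F

lemma Lip1 {d : ℕ} (F : SS d) (R : ℝ) (hR : 0 ≤ R) : ∃ C : ℝ, 0 ≤ C ∧ ∀ G1 G2 : Fin d → CT,
    (∀ l, N 2 (G1 l) ≤ ENNReal.ofReal R) → (∀ l, N 2 (G2 l) ≤ ENNReal.ofReal R) →
    N 1 (cmp F G1 - cmp F G2) ≤ ENNReal.ofReal C * ∑ l, N 1 (G1 l - G2 l) := by
  obtain ⟨C1, hC1, h1⟩ := exists_common (fun l C => ∀ G : Fin d → CT,
    (∀ l, N 2 (G l) ≤ ENNReal.ofReal R) → N 1 (cmp (F.pd l) G) ≤ ENNReal.ofReal C)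
    (fun l => B1 (F.pd l) R hR) (fun l C C' h H G hG => (H G hG).trans (by gcongr))
  exact ⟨C1, hC1, fun G1 G2 h1' h2' => Lip F 1 C1 _ _ fun l τ hτ => h1 l _ fun m =>
    N_seg _ _ _ _ (h1' m) (h2' m) τ hτ⟩

end Hopf

namespace Hopf

/-- real bound on the Wiener norm -/
def Bd (s : ℕ) (f : CT) (C : ℝ) : Prop := 0 ≤ C ∧ N s f ≤ ENNReal.ofReal C

lemma Bd.add {s : ℕ} {f g : CT} {C C' : ℝ} (h : Bd s f C) (h' : Bd s g C') : Bd s (f + g) (C + C') :=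
  ⟨add_nonneg h.1 h'.1, by
    rw [ENNReal.ofReal_add h.1 h'.1]
    exact (N_add _ _ _).trans (add_le_add h.2 h'.2)⟩

lemma Bd.sub {s : ℕ} {f g : CT} {C C' : ℝ} (h : Bd s f C) (h' : Bd s g C') : Bd s (f - g) (C + C') :=
  ⟨add_nonneg h.1 h'.1, by
    rw [ENNReal.ofReal_add h.1 h'.1]
    exact (N_sub _ _ _).trans (add_le_add h.2 h'.2)⟩

lemma Bd.smul {s : ℕ} {f : CT} {C : ℝ} (c : ℂ) (h : Bd s f C) : Bd s (c • f) (‖c‖ * C) :=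
  ⟨mul_nonneg (norm_nonneg _) h.1, by
    rw [ENNReal.ofReal_mul (norm_nonneg _), N_smul, ofReal_norm]
    exact mul_le_mul_right h.2 _⟩

lemma Bd.ne_top {s : ℕ} {f : CT} {C : ℝ} (h : Bd s f C) : N s f ≠ ⊤ :=
  ne_top_of_le_ne_top ENNReal.ofReal_ne_top h.2

lemma Bd.mul {s : ℕ} {f g : CT} {C C' : ℝ} (h : Bd s f C) (h' : Bd s g C') : Bd s (f * g) (C * C') :=
  ⟨mul_nonneg h.1 h'.1, by
    rw [ENNReal.ofReal_mul h.1]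
    exact (N_mul h.ne_top _).trans (mul_le_mul' h.2 h'.2)⟩

lemma Bd.mono {s : ℕ} {f : CT} {C C' : ℝ} (h : Bd s f C) (hC : C ≤ C') : Bd s f C' :=
  ⟨h.1.trans hC, h.2.trans (ENNReal.ofReal_le_ofReal hC)⟩

lemma Bd.le {s s' : ℕ} {f : CT} {C : ℝ} (h : Bd s f C) (hs : s' ≤ s) : Bd s' f C :=
  ⟨h.1, (N_mono hs f).trans h.2⟩

lemma Bd.norm_le {s : ℕ} {f : CT} {C : ℝ} (h : Bd s f C) : ‖f‖ ≤ C :=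
  norm_le_of_N h.1 (h.le (Nat.zero_le s)).2

lemma Bd.sum {s : ℕ} {ι : Type*} (S : Finset ι) {f : ι → CT} {C : ι → ℝ} (h : ∀ i ∈ S, Bd s (f i) (C i)) :
    Bd s (∑ i ∈ S, f i) (∑ i ∈ S, C i) := by
  refine ⟨Finset.sum_nonneg fun i hi => (h i hi).1, ?_⟩
  rw [ENNReal.ofReal_sum_of_nonneg fun i hi => (h i hi).1]
  exact (N_sum _ _ _).trans (Finset.sum_le_sum fun i hi => (h i hi).2)

lemma Bd.zero (s : ℕ) {C : ℝ} (hC : 0 ≤ C) : Bd s 0 C := ⟨hC, by rw [N_zero]; exact zero_le⟩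

lemma Bd.const (s : ℕ) (c : ℂ) {C : ℝ} (hC : ‖c‖ ≤ C) : Bd s (ContinuousMap.const Tor c) C :=
  ⟨(norm_nonneg _).trans hC, by
    rw [N_const, ← ofReal_norm]; exact ENNReal.ofReal_le_ofReal hC⟩

lemma Bd.lim {s : ℕ} {f : ℕ → CT} {g : CT} {C : ℝ} (hf : Tendsto f atTop (𝓝 g))
    (h : ∀ᶠ n in atTop, Bd s (f n) C) : Bd s g C := by
  obtain ⟨n0, hn0⟩ := h.exists
  refine ⟨hn0.1, N_le_of_dual _ _ _ fun S α hα => ?_⟩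
  have ht : Tendsto (fun n => ∑ k ∈ S, (((wt k : ℝ) ^ s : ℝ) : ℂ) * α k * cf (f n) k) atTop
      (𝓝 (∑ k ∈ S, (((wt k : ℝ) ^ s : ℝ) : ℂ) * α k * cf g k)) := by
    refine tendsto_finsetSum _ fun k _ => ?_
    exact (((cfL k).continuous.tendsto g).comp hf).const_mul _
  refine le_of_tendsto ht.enorm ?_
  filter_upwards [h] with n hn
  exact (dual_le_N s (f n) S α hα).trans hn.2

lemma fixpt {d : ℕ} (Φ : (Fin d → CT) → (Fin d → CT)) (B : ℝ) (hB : 0 ≤ B)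
    (h0 : ∀ ω, (∀ l, Bd 1 (ω l) B) → ∀ l, Bd 1 (Φ ω l) B)
    (hL : ∀ ω ω', (∀ l, Bd 1 (ω l) B) → (∀ l, Bd 1 (ω' l) B) → ∀ D, (∀ l, Bd 1 (ω l - ω' l) D) →
      ∀ i, Bd 1 (Φ ω i - Φ ω' i) (D / 2)) : ∃ ω, (∀ l, Bd 1 (ω l) B) ∧ Φ ω = ω := by
  set a : ℕ → (Fin d → CT) := fun n => Φ^[n] 0 with ha
  have ha1 : ∀ n, a (n + 1) = Φ (a n) := fun n => Function.iterate_succ_apply' Φ n 0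
  have hball : ∀ n l, Bd 1 (a n l) B := by
    intro n
    induction n with
    | zero => intro l; exact Bd.zero _ hB
    | succ n ih => rw [ha1]; exact h0 _ ih
  have hdiff : ∀ n j l, Bd 1 (a (j + n) l - a n l) (B / 2 ^ n) := by
    intro n
    induction n with
    | zero =>
      intro j l
      have : a (j + 0) l - a 0 l = a j l := by simp [ha]
      rw [this]; simpa using hball j l
    | succ n ih =>
      intro j l
      have := hL _ _ (hball (j + n)) (hball n) _ (ih j) l
      rw [← add_assoc, ha1, ha1, pow_succ, ← div_div]
      exact this
  have hlim : ∀ l, ∃ g : CT, Tendsto (fun n => a n l) atTop (𝓝 g) := by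
    intro l
    refine cauchySeq_tendsto_of_complete (cauchySeq_of_le_geometric (1 / 2) B (by norm_num) fun n => ?_)
    rw [dist_comm, dist_eq_norm]
    have := (hdiff n 1 l).norm_le
    rw [add_comm 1 n] at this
    refine this.trans (le_of_eq ?_)
    rw [one_div, inv_pow, div_eq_mul_inv]
  choose L hLim using hlim
  have hLB : ∀ l, Bd 1 (L l) B := fun l => Bd.lim (hLim l) (Eventually.of_forall fun n => hball n l)
  have hLd : ∀ n l, Bd 1 (L l - a n l) (B / 2 ^ n) := by
    intro n l
    refine Bd.lim ((hLim l).sub_const (a n l)) ?_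
    filter_upwards [eventually_ge_atTop n] with m hm
    obtain ⟨j, rfl⟩ := Nat.exists_eq_add_of_le' hm
    exact hdiff n j l
  refine ⟨L, hLB, ?_⟩
  ext l : 1
  have key : ∀ n, ‖Φ L l - L l‖ ≤ B * (1 / 2) ^ n := by
    intro n
    have h1 := hL _ _ hLB (hball n) _ (hLd n) l
    have h2 := hLd (n + 1) l
    have h3 := (h1.sub h2).norm_le
    rw [ha1] at h3
    rw [show Φ L l - Φ (a n) l - (L l - Φ (a n) l) = Φ L l - L l by abel] at h3
    refine h3.trans (le_of_eq ?_)
    rw [pow_succ, one_div, inv_pow]; field_simp; ring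
  have ht : Tendsto (fun n : ℕ => B * (1 / 2 : ℝ) ^ n) atTop (𝓝 (B * 0)) :=
    (_root_.tendsto_pow_atTop_nhds_zero_of_lt_one (by norm_num) (by norm_num)).const_mul B
  have h5 := ge_of_tendsto' ht key
  rw [mul_zero] at h5
  have := norm_le_zero_iff.mp h5
  exact sub_eq_zero.mp this

lemma ext_cf {f g : CT} (h : ∀ k, cf f k = cf g k) : f = g := by
  have h0 : N 0 (f - g) = 0 := by
    unfold N; simp [cf_sub, h]
  have := enorm_le_N (f - g)
  rw [h0] at this
  have hn : ‖f - g‖ ≤ 0 := by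
    rw [← ofReal_norm] at this
    exact ENNReal.ofReal_eq_zero.mp (le_antisymm this zero_le)
  have : f - g = 0 := norm_le_zero_iff.mp hn
  exact sub_eq_zero.mp this

/-- Fourier multiplier -/
noncomputable def mo (c : Fq → ℂ) (f : CT) : CT := ∑' k, (c k * cf f k) • ee k

lemma norm_ee_le (k : Fq) : ‖ee k‖ ≤ 1 := by
  rw [ContinuousMap.norm_le _ zero_le_one]
  intro x; rw [norm_ee_apply]

lemma cf_mo_of_summable {c : Fq → ℂ} {f : CT} (h : Summable fun k => c k * cf f k) (k : Fq) :
    cf (mo c f) k = c k * cf f k := by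
  have hs : Summable fun k => (c k * cf f k) • ee k := by
    refine Summable.of_norm_bounded h.norm fun k => ?_
    rw [norm_smul]
    exact mul_le_of_le_one_right (norm_nonneg _) (norm_ee_le k)
  have := (cfL k).hasSum hs.hasSum
  rw [← cfL_apply]
  refine (HasSum.unique this ?_)
  have h2 := hasSum_ite_eq k (c k * cf f k)
  refine h2.congr_fun ?_ |> fun h => h
  intro m
  simp only [map_smul, cfL_apply, cf_ee, smul_eq_mul]
  by_cases hm : m = k
  · simp [hm]
  · simp [hm, Ne.symm hm]

lemma mo_summable {c : Fq → ℂ} {f : CT} {K C : ℝ} {s s' : ℕ} (hf : Bd s f C)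
    (hc : ∀ k, ‖c k‖ * (wt k : ℝ) ^ s' ≤ K * (wt k : ℝ) ^ s) : Summable fun k => c k * cf f k := by
  have hfin := hf.ne_top
  unfold N at hfin
  have h1 : Summable fun k => ((wt k : ℝ) ^ s) * ‖cf f k‖ := by
    have := ENNReal.summable_toReal hfin
    refine this.congr fun k => ?_
    rw [ENNReal.toReal_mul]; simp
  refine Summable.of_norm_bounded (h1.mul_left K) fun k => ?_
  rw [norm_mul, ← mul_assoc]
  gcongr
  refine le_trans ?_ (hc k)
  have : (1 : ℝ) ≤ (wt k : ℝ) ^ s' := one_le_pow₀ (by exact_mod_cast one_le_wt k)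
  exact le_mul_of_one_le_right (norm_nonneg _) this

lemma Bd.mo {c : Fq → ℂ} {f : CT} {K C : ℝ} {s s' : ℕ} (hf : Bd s f C) (hK : 0 ≤ K)
    (hc : ∀ k, ‖c k‖ * (wt k : ℝ) ^ s' ≤ K * (wt k : ℝ) ^ s) : Bd s' (mo c f) (K * C) := by
  refine ⟨mul_nonneg hK hf.1, ?_⟩
  have hs := mo_summable hf hc
  rw [ENNReal.ofReal_mul hK]
  refine le_trans ?_ (mul_le_mul_right hf.2 _)
  unfold N
  rw [← ENNReal.tsum_mul_left]
  refine ENNReal.tsum_le_tsum fun k => ?_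
  rw [cf_mo_of_summable hs, enorm_mul, ← mul_assoc, ← mul_assoc]
  refine mul_le_mul_left ?_ _
  rw [mul_comm, ← ENNReal.ofReal_coe_nnreal, ← ENNReal.ofReal_coe_nnreal, ← ofReal_norm, ← ENNReal.ofReal_mul (norm_nonneg _),
    ← ENNReal.ofReal_mul hK]
  refine ENNReal.ofReal_le_ofReal ?_
  push_cast
  exact hc k

/-- partial derivatives -/
noncomputable def Dx (j : Fin 2) (f : CT) : CT := mo (fun k => 2 * Real.pi * I * (k j)) f

/-- inverse Laplacian of derivative -/
noncomputable def Mx (j : Fin 2) (f : CT) : CT :=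
  mo (fun k => (k j) / (2 * Real.pi * I * ((k 0) ^ 2 + (k 1) ^ 2))) f

lemma Dx_bd (j : Fin 2) (s : ℕ) (k : Fq) : ‖(2 * Real.pi * I * (k j) : ℂ)‖ * (wt k : ℝ) ^ s
    ≤ 2 * Real.pi * (wt k : ℝ) ^ (s + 1) := by
  have : ‖(2 * Real.pi * I * (k j) : ℂ)‖ = 2 * Real.pi * |(k j : ℝ)| := by
    simp [abs_of_pos Real.pi_pos]
  rw [this, pow_succ, mul_assoc, mul_comm ((wt k : ℝ) ^ s)]
  gcongr
  exact abs_le_wt k j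

lemma Mx_bd (j : Fin 2) (s : ℕ) (k : Fq) :
    ‖((k j) / (2 * Real.pi * I * ((k 0) ^ 2 + (k 1) ^ 2)) : ℂ)‖ * (wt k : ℝ) ^ (s + 1)
    ≤ 1 * (wt k : ℝ) ^ s := by
  have e : ((2 * Real.pi * I * ((k 0) ^ 2 + (k 1) ^ 2)) : ℂ) = ((2 * Real.pi * ((k 0 : ℝ) ^ 2 + (k 1 : ℝ) ^ 2) : ℝ) : ℂ) * I := by
    push_cast; ring
  have e' : ‖((k j) / (2 * Real.pi * I * ((k 0) ^ 2 + (k 1) ^ 2)) : ℂ)‖ = |(k j : ℝ)| / (2 * Real.pi * ((k 0 : ℝ) ^ 2 + (k 1 : ℝ) ^ 2)) := by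
    rw [e, norm_div, norm_mul, Complex.norm_real, Complex.norm_I, mul_one, Real.norm_of_nonneg (by positivity)]
    simp
  rw [e', pow_succ (wt k : ℝ), mul_comm _ (wt k : ℝ), ← mul_assoc]
  gcongr
  by_cases hz : k 0 = 0 ∧ k 1 = 0
  · simp [hz.1, hz.2]
  have hpos : 0 < (k 0 : ℝ) ^ 2 + (k 1 : ℝ) ^ 2 := by
    by_cases h0 : k 0 = 0
    · have : k 1 ≠ 0 := fun h => hz ⟨h0, h⟩
      have : (k 1 : ℝ) ≠ 0 := by exact_mod_cast this
      positivity
    · have : (k 0 : ℝ) ≠ 0 := by exact_mod_cast h0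
      positivity
  rw [div_mul_eq_mul_div, div_le_one (by positivity)]
  have hw : (wt k : ℝ) = 1 + |(k 0 : ℝ)| + |(k 1 : ℝ)| := by
    simp [wt, Int.norm_eq_abs]
  have hkj : ∀ j, |(k j : ℝ)| ≤ (k j : ℝ) ^ 2 := by
    intro j
    have : |k j| ≤ (k j) ^ 2 := by rw [Int.abs_eq_natAbs]; exact Int.natAbs_le_self_sq _
    exact_mod_cast this
  have hp := Real.pi_gt_three
  have h0 := hkj 0
  have h1 := hkj 1
  have s0 := sq_abs (k 0 : ℝ)
  have s1 := sq_abs (k 1 : ℝ)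
  have a0 := abs_nonneg (k 0 : ℝ)
  have a1 := abs_nonneg (k 1 : ℝ)
  have hj : |(k j : ℝ)| * (wt k : ℝ) ≤ 6 * ((k 0 : ℝ) ^ 2 + (k 1 : ℝ) ^ 2) := by
    rw [hw]
    fin_cases j
    · simp only [Fin.zero_eta]
      nlinarith [sq_nonneg (|(k 0 : ℝ)| - |(k 1 : ℝ)|)]
    · simp only [Fin.mk_one]
      nlinarith [sq_nonneg (|(k 0 : ℝ)| - |(k 1 : ℝ)|)]
  refine hj.trans ?_
  gcongr
  linarith

lemma Bd.dx {f : CT} {C : ℝ} {s : ℕ} (hf : Bd (s + 1) f C) (j : Fin 2) : Bd s (Dx j f) (2 * Real.pi * C) :=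
  hf.mo (by positivity) (Dx_bd j s)

lemma Bd.mx {f : CT} {C : ℝ} {s : ℕ} (hf : Bd s f C) (j : Fin 2) : Bd (s + 1) (Mx j f) C := by
  have := hf.mo zero_le_one (Mx_bd j s)
  rwa [one_mul] at this

lemma cf_Dx {f : CT} {C : ℝ} (hf : Bd 1 f C) (j : Fin 2) (k : Fq) : cf (Dx j f) k = 2 * Real.pi * I * (k j) * cf f k :=
  cf_mo_of_summable (mo_summable (s := 1) (s' := 0) hf (Dx_bd j 0)) k

lemma cf_Mx {f : CT} {C : ℝ} (hf : Bd 0 f C) (j : Fin 2) (k : Fq) :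
    cf (Mx j f) k = (k j) / (2 * Real.pi * I * ((k 0) ^ 2 + (k 1) ^ 2)) * cf f k :=
  cf_mo_of_summable (mo_summable (s := 0) (s' := 1) hf (Mx_bd j 0)) k

lemma Dx_add {f g : CT} {C C' : ℝ} (hf : Bd 1 f C) (hg : Bd 1 g C') (j : Fin 2) : Dx j (f + g) = Dx j f + Dx j g := by
  refine ext_cf fun k => ?_
  rw [cf_add, cf_Dx (hf.add hg), cf_Dx hf, cf_Dx hg, cf_add]; ring

lemma Dx_sub {f g : CT} {C C' : ℝ} (hf : Bd 1 f C) (hg : Bd 1 g C') (j : Fin 2) : Dx j (f - g) = Dx j f - Dx j g := by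
  refine ext_cf fun k => ?_
  rw [cf_sub, cf_Dx (hf.sub hg), cf_Dx hf, cf_Dx hg, cf_sub]; ring

lemma Dx_smul {f : CT} {C : ℝ} (hf : Bd 1 f C) (c : ℂ) (j : Fin 2) : Dx j (c • f) = c • Dx j f := by
  refine ext_cf fun k => ?_
  rw [cf_smul, cf_Dx (hf.smul c), cf_Dx hf, cf_smul]; ring

lemma Mx_sub {f g : CT} {C C' : ℝ} (hf : Bd 0 f C) (hg : Bd 0 g C') (j : Fin 2) : Mx j (f - g) = Mx j f - Mx j g := by
  refine ext_cf fun k => ?_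
  rw [cf_sub, cf_Mx (hf.sub hg), cf_Mx hf, cf_Mx hg, cf_sub]; ring

lemma Dx_sum {ι : Type*} (S : Finset ι) {f : ι → CT} {C : ι → ℝ} (h : ∀ i ∈ S, Bd 1 (f i) (C i)) (j : Fin 2) :
    Dx j (∑ i ∈ S, f i) = ∑ i ∈ S, Dx j (f i) := by
  refine ext_cf fun k => ?_
  have e : ∀ g : ι → CT, cf (∑ i ∈ S, g i) k = ∑ i ∈ S, cf (g i) k := fun g => map_sum (cfL k) g S
  rw [cf_Dx (Bd.sum S h), e, e, Finset.mul_sum]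
  exact Finset.sum_congr rfl fun i hi => (cf_Dx (h i hi) j k).symm

/-- the covering map -/
noncomputable def pt (z : ℂ) : Tor := fun j => if j = 0 then (z.re : UnitAddCircle) else (z.im : UnitAddCircle)

lemma pt_add (z w : ℂ) : pt (z + w) = pt z + pt w := by
  ext j; unfold pt; by_cases h : j = 0 <;> simp [h]

lemma pt_zero : pt 0 = 0 := by
  ext j; unfold pt; by_cases h : j = 0 <;> simp [h]

lemma ee_pt (k : Fq) (z : ℂ) : ee k (pt z) = Complex.exp ((2 * Real.pi * ((k 0) * z.re + (k 1) * z.im) : ℝ) * I) := by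
  have : pt z = hh 0 z.re + hh 1 z.im := by
    ext j; fin_cases j <;> simp [pt, hh]
  rw [this, ee_apply_add, ee_hh, ee_hh, ← Complex.exp_add]
  congr 1; push_cast; ring

lemma exp_second (θ : ℝ) : ‖Complex.exp (θ * I) - 1 - θ * I‖ ≤ 3 * θ ^ 2 := by
  have hn : ‖(θ * I : ℂ)‖ = |θ| := by simp
  by_cases h : |θ| ≤ 1
  · have := Complex.norm_exp_sub_one_sub_id_le (x := θ * I) (by rw [hn]; exact h)
    rw [hn, sq_abs] at this
    nlinarith [sq_nonneg θ]
  · push Not at h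
    have h1 : ‖Complex.exp (θ * I) - 1 - θ * I‖ ≤ 1 + 1 + |θ| := by
      refine (norm_sub_le _ _).trans ?_
      rw [hn]
      gcongr
      refine (norm_sub_le _ _).trans ?_
      rw [Complex.norm_exp_ofReal_mul_I]; simp
    nlinarith [sq_abs θ]

lemma quad {f : CT} {C : ℝ} (hf : Bd 2 f C) (z w : ℂ) :
    ‖f (pt (z + w)) - f (pt z) - (w.re * Dx 0 f (pt z) + w.im * Dx 1 f (pt z))‖ ≤ 12 * (2 * Real.pi) ^ 2 * C * ‖w‖ ^ 2 := by
  have hf1 : Bd 1 f C := hf.le (by norm_num)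
  set E : CT := tr (pt w) f - f - ((w.re : ℂ) • Dx 0 f + (w.im : ℂ) • Dx 1 f) with hE
  have hEz : f (pt (z + w)) - f (pt z) - (w.re * Dx 0 f (pt z) + w.im * Dx 1 f (pt z)) = E (pt z) := by
    simp [hE, pt_add]
  rw [hEz]
  refine (E.norm_coe_le_norm _).trans ?_
  have hC := hf.1
  refine norm_le_of_N (by positivity) ?_
  have hcf : ∀ k, ‖cf E k‖ ≤ (12 * (2 * Real.pi) ^ 2 * ‖w‖ ^ 2) * ((wt k : ℝ) ^ 2 * ‖cf f k‖) := by
    intro k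
    set θ : ℝ := 2 * Real.pi * ((k 0) * w.re + (k 1) * w.im) with hθ
    have e : cf E k = (Complex.exp (θ * I) - 1 - θ * I) * cf f k := by
      rw [hE, cf_sub, cf_sub, cf_tr, cf_add, cf_smul, cf_smul, cf_Dx hf1, cf_Dx hf1, ee_pt, ← hθ]
      rw [hθ]; push_cast; ring
    rw [e, norm_mul, ← mul_assoc]
    gcongr
    refine (exp_second θ).trans ?_
    have h1 : |θ| ≤ 2 * Real.pi * (2 * (wt k * ‖w‖)) := by
      rw [hθ, abs_mul, abs_of_pos (by positivity : 0 < 2 * Real.pi)]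
      gcongr
      refine (abs_add_le _ _).trans ?_
      rw [abs_mul, abs_mul, two_mul]
      gcongr
      · exact abs_le_wt k 0
      · exact Complex.abs_re_le_norm w
      · exact abs_le_wt k 1
      · exact Complex.abs_im_le_norm w
    have h2 : θ ^ 2 ≤ (2 * Real.pi * (2 * (wt k * ‖w‖))) ^ 2 := by
      rw [← sq_abs θ]; gcongr
    calc 3 * θ ^ 2 ≤ 3 * (2 * Real.pi * (2 * (wt k * ‖w‖))) ^ 2 := by gcongr
      _ = _ := by ring
  rw [show 12 * (2 * Real.pi) ^ 2 * C * ‖w‖ ^ 2 = (12 * (2 * Real.pi) ^ 2 * ‖w‖ ^ 2) * C by ring,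
    ENNReal.ofReal_mul (by positivity)]
  refine le_trans ?_ (mul_le_mul_right hf.2 _)
  unfold N
  rw [← ENNReal.tsum_mul_left]
  refine ENNReal.tsum_le_tsum fun k => ?_
  rw [pow_zero, ENNReal.coe_one, one_mul, ← ofReal_norm, ← ofReal_norm, ← ENNReal.ofReal_coe_nnreal (p := wt k ^ 2), ← ENNReal.ofReal_mul (by positivity),
    ← ENNReal.ofReal_mul (by positivity)]
  refine ENNReal.ofReal_le_ofReal ?_
  push_cast
  exact hcf k

end Hopf

namespace Hopf

/-- the derivative along the covering map -/
noncomputable def Lx (f : CT) (z : ℂ) : ℂ →L[ℝ] ℂ :=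
  Complex.reCLM.smulRight (Dx 0 f (pt z)) + Complex.imCLM.smulRight (Dx 1 f (pt z))

lemma Lx_apply (f : CT) (z w : ℂ) : Lx f z w = w.re * Dx 0 f (pt z) + w.im * Dx 1 f (pt z) := by
  simp [Lx]

lemma hasFDerivAt_pt {f : CT} {C : ℝ} (hf : Bd 2 f C) (z : ℂ) :
    HasFDerivAt (fun z => f (pt z)) (Lx f z) z := by
  rw [hasFDerivAt_iff_isLittleO_nhds_zero]
  have h1 : (fun w : ℂ => f (pt (z + w)) - f (pt z) - Lx f z w) =O[𝓝 0] fun w => ‖w‖ ^ 2 := by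
    refine Asymptotics.IsBigO.of_bound (12 * (2 * Real.pi) ^ 2 * C) (Eventually.of_forall fun w => ?_)
    rw [Lx_apply, norm_pow, norm_norm]
    exact quad hf z w
  refine h1.trans_isLittleO ?_
  have := Asymptotics.isLittleO_norm_pow_id (E' := ℂ) (n := 2) (by norm_num)
  exact this

lemma eta_smooth : ∃ F : SS 1, ∀ x : Fin 1 → ℝ, ‖x‖ ≤ 1 / 4 → F.1 x = Real.arcsin (x 0) / (2 * Real.pi) := by
  let χ : ContDiffBump (0 : Fin 1 → ℝ) := ⟨1 / 4, 1 / 2, by norm_num, by norm_num⟩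
  refine ⟨⟨fun x => χ x * (Real.arcsin (x 0) / (2 * Real.pi)), ?_, ?_⟩, ?_⟩
  · rw [contDiff_iff_contDiffAt]
    intro x
    by_cases hx : ‖x‖ < 1
    · have h0 : |x 0| < 1 := (norm_le_pi_norm x 0).trans_lt hx
      rw [abs_lt] at h0
      refine χ.contDiff.contDiffAt.mul (ContDiffAt.div_const ?_ _)
      have h1 : ContDiffAt ℝ (⊤ : ℕ∞) Real.arcsin (x 0) :=
        Real.contDiffAt_arcsin (by linarith) (by linarith)
      exact ContDiffAt.comp (g := Real.arcsin) (f := fun x : Fin 1 → ℝ => x 0) x h1 (contDiff_apply ℝ ℝ (0 : Fin 1)).contDiffAt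
    · push Not at hx
      have : (fun x : Fin 1 → ℝ => χ x * (Real.arcsin (x 0) / (2 * Real.pi))) =ᶠ[𝓝 x] fun _ => 0 := by
        have ho : IsOpen {y : Fin 1 → ℝ | 1 / 2 < ‖y‖} := isOpen_lt continuous_const continuous_norm
        filter_upwards [ho.mem_nhds (show 1 / 2 < ‖x‖ by linarith)] with y hy
        rw [χ.zero_of_le_dist (by simpa [dist_eq_norm, χ] using hy.le), zero_mul]
      exact contDiffAt_const.congr_of_eventuallyEq this
  · exact χ.hasCompactSupport.mul_right
  · intro x hx
    simp only
    rw [χ.one_of_mem_closedBall (by simpa [mem_closedBall, dist_eq_norm, χ] using hx), one_mul]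

/-- coordinate function -/
noncomputable def co (j : Fin 2) (z : ℂ) : ℝ := if j = 0 then z.re else z.im

lemma exists_eta (j : Fin 2) : ∃ (η : CT) (H ρ : ℝ), 0 < ρ ∧ Bd 2 η H ∧
    ∀ z : ℂ, ‖z‖ < ρ → η (pt z) = co j z := by
  obtain ⟨F, hF⟩ := eta_smooth
  set k : Fq := Pi.single j 1 with hk
  set G0 : CT := (1 / (2 * I) : ℂ) • (ee k - ee (-k)) with hG0
  obtain ⟨R, hR0, hR⟩ : ∃ R : ℝ, 0 ≤ R ∧ N 2 G0 ≤ ENNReal.ofReal R := by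
    have : N 2 G0 ≠ ⊤ := by
      rw [hG0, N_smul]
      refine ENNReal.mul_ne_top enorm_ne_top (ne_top_of_le_ne_top ?_ (N_sub _ _ _))
      rw [N_ee, N_ee]; simp
    exact ⟨(N 2 G0).toReal, ENNReal.toReal_nonneg, by rw [ENNReal.ofReal_toReal this]⟩
  obtain ⟨C, hC0, hC⟩ := B2 F R hR0
  have hB := hC (fun _ => G0) (fun _ => hR)
  refine ⟨cmp F (fun _ => G0), C, 1 / 100, by norm_num, ⟨hC0, hB⟩, fun z hz => ?_⟩
  rw [cmp_apply]
  norm_cast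
  have hco : |co j z| < 1 / 100 := by
    refine lt_of_le_of_lt ?_ hz
    unfold co; split_ifs
    · exact Complex.abs_re_le_norm z
    · exact Complex.abs_im_le_norm z
  have hrv : rv (fun _ : Fin 1 => G0) (pt z) = fun _ => Real.sin (2 * Real.pi * co j z) := by
    ext l
    have h1 : ((k 0) * z.re + (k 1) * z.im : ℝ) = co j z := by
      rw [hk]; unfold co; fin_cases j <;> simp
    have h2 : (((-k) 0 : ℤ) * z.re + ((-k) 1 : ℤ) * z.im : ℝ) = - co j z := by
      rw [← h1]; simp; ring
    simp only [rv, hG0, ContinuousMap.smul_apply, ContinuousMap.sub_apply, smul_eq_mul]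
    rw [ee_pt, ee_pt, h1, h2]
    have : (1 / (2 * I) : ℂ) * (Complex.exp ((2 * Real.pi * co j z : ℝ) * I) - Complex.exp ((2 * Real.pi * -co j z : ℝ) * I))
      = ((Real.sin (2 * Real.pi * co j z) : ℝ) : ℂ) := by
      rw [Complex.ofReal_sin, Complex.sin]
      push_cast
      field_simp
      rw [I_sq]
      ring_nf
    rw [this, Complex.ofReal_re]
  rw [hrv]
  have hp := Real.pi_lt_four
  have hp0 := Real.pi_pos
  have hs : |2 * Real.pi * co j z| ≤ 1 / 4 := by
    rw [abs_mul, abs_of_pos (by positivity)]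
    nlinarith [abs_nonneg (co j z)]
  rw [hF]
  · rw [abs_le] at hs
    rw [Real.arcsin_sin (by linarith [Real.pi_gt_three]) (by linarith [Real.pi_gt_three])]
    field_simp
  · rw [pi_norm_le_iff_of_nonneg (by norm_num)]
    intro _
    rw [Real.norm_eq_abs]
    refine (Real.abs_sin_le_abs).trans hs

lemma exists_eta' (j : Fin 2) : ∃ (η : CT) (H ρ : ℝ), 0 < ρ ∧ Bd 2 η H ∧
    ∀ z : ℂ, ‖z‖ < ρ → ∀ i, Dx i η (pt z) = if i = j then 1 else 0 := by
  obtain ⟨η, H, ρ, hρ, hH, h⟩ := exists_eta j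
  refine ⟨η, H, ρ, hρ, hH, fun z hz i => ?_⟩
  have h1 := hasFDerivAt_pt hH z
  have he : (fun z => η (pt z)) =ᶠ[𝓝 z] fun z => (co j z : ℂ) := by
    have ho : IsOpen {z : ℂ | ‖z‖ < ρ} := isOpen_lt continuous_norm continuous_const
    filter_upwards [ho.mem_nhds hz] with w hw using h w hw
  have h2 : HasFDerivAt (fun z => (co j z : ℂ)) (if j = 0 then Complex.ofRealCLM.comp Complex.reCLM
      else Complex.ofRealCLM.comp Complex.imCLM) z := by
    by_cases hj : j = 0
    · simp only [hj, if_true, co]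
      exact (Complex.ofRealCLM.comp Complex.reCLM).hasFDerivAt
    · simp only [hj, if_false, co]
      exact (Complex.ofRealCLM.comp Complex.imCLM).hasFDerivAt
  have h3 := (h2.congr_of_eventuallyEq he).unique h1
  have e0 : Dx 0 η (pt z) = Lx η z 1 := by rw [Lx_apply]; simp
  have e1 : Dx 1 η (pt z) = Lx η z I := by rw [Lx_apply]; simp
  fin_cases i <;> fin_cases j <;> simp only [Fin.zero_eta, Fin.mk_one, e0, e1, ← h3] <;> simp

/-- right inverse of the model operator -/
noncomputable def Tm {d : ℕ} (A0 : Fin d → Fin d → ℝ) (ω : Fin d → CT) (i : Fin d) : CT :=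
  Mx 1 (ω i) + ∑ j, (A0 i j : ℂ) • Mx 0 (ω j)

lemma Tm_bd {d : ℕ} {A0 : Fin d → Fin d → ℝ} {a : ℝ} (hA : ∀ i j, |A0 i j| ≤ a) {ω : Fin d → CT} {D : ℝ}
    (hω : ∀ l, Bd 1 (ω l) D) (i : Fin d) : Bd 2 (Tm A0 ω i) ((1 + d * a) * D) := by
  have h2 : Bd 2 (∑ j, (A0 i j : ℂ) • Mx 0 (ω j)) (∑ j : Fin d, a * D) := by
    refine Bd.sum _ fun j _ => ?_
    refine (((hω j).mx 0).smul _).mono ?_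
    rw [Complex.norm_real]
    exact mul_le_mul_of_nonneg_right (hA i j) (hω j).1
  refine (((hω i).mx 1).add h2).mono (le_of_eq ?_)
  simp; ring

lemma Tm_sub {d : ℕ} {A0 : Fin d → Fin d → ℝ} {ω ω' : Fin d → CT} {D D' : ℝ}
    (hω : ∀ l, Bd 1 (ω l) D) (hω' : ∀ l, Bd 1 (ω' l) D') (i : Fin d) :
    Tm A0 (fun l => ω l - ω' l) i = Tm A0 ω i - Tm A0 ω' i := by
  unfold Tm
  have h : ∀ l j, Mx j (ω l - ω' l) = Mx j (ω l) - Mx j (ω' l) := fun l j =>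
    Mx_sub ((hω l).le (by norm_num)) ((hω' l).le (by norm_num)) j
  simp only [h, smul_sub, Finset.sum_sub_distrib]
  abel

lemma Tm_eq {d : ℕ} {A0 : Fin d → Fin d → ℝ}
    (hA2 : ∀ i j, ∑ l, A0 i l * A0 l j = if i = j then -1 else 0) {ω : Fin d → CT} {D : ℝ}
    (hω : ∀ l, Bd 1 (ω l) D) (i : Fin d) :
    Dx 1 (Tm A0 ω i) - ∑ j, (A0 i j : ℂ) • Dx 0 (Tm A0 ω j) = ω i - (cf (ω i) 0) • (1 : CT) := by
  obtain ⟨a, ha⟩ : ∃ a, ∀ i j, |A0 i j| ≤ a := by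
    refine ⟨∑ i, ∑ j, |A0 i j|, fun i j => ?_⟩
    refine (Finset.single_le_sum (f := fun j => |A0 i j|) (fun _ _ => abs_nonneg _) (Finset.mem_univ j)).trans ?_
    exact Finset.single_le_sum (f := fun i => ∑ j, |A0 i j|) (fun _ _ => Finset.sum_nonneg fun _ _ => abs_nonneg _) (Finset.mem_univ i)
  refine ext_cf fun k => ?_
  have es : ∀ g : Fin d → CT, cf (∑ i, g i) k = ∑ i, cf (g i) k := fun g => map_sum (cfL k) g _
  have hT : ∀ l, Bd 1 (Tm A0 ω l) ((1 + d * a) * D) := fun l => (Tm_bd ha hω l).le (by norm_num)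
  rw [cf_sub, cf_sub, es, cf_Dx (hT i), cf_smul, cf_one]
  simp only [cf_smul, cf_Dx (hT _)]
  have hTk : ∀ l, cf (Tm A0 ω l) k = (k 1) / (2 * Real.pi * I * ((k 0) ^ 2 + (k 1) ^ 2)) * cf (ω l) k +
      (k 0) / (2 * Real.pi * I * ((k 0) ^ 2 + (k 1) ^ 2)) * ∑ j, A0 l j * cf (ω j) k := by
    intro l
    unfold Tm
    rw [cf_add, es, cf_Mx ((hω l).le (by norm_num)), Finset.mul_sum]
    congr 1
    refine Finset.sum_congr rfl fun j _ => ?_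
    rw [cf_smul, cf_Mx ((hω j).le (by norm_num))]; ring
  simp only [hTk]
  set s : ℂ := 2 * Real.pi * I * ((k 0) ^ 2 + (k 1) ^ 2) with hs
  have hAA : ∑ j, (A0 i j : ℂ) * ∑ l, A0 j l * cf (ω l) k = - cf (ω i) k := by
    simp only [Finset.mul_sum]
    rw [Finset.sum_comm]
    have : ∀ l, ∑ j, (A0 i j : ℂ) * (A0 j l * cf (ω l) k) = (if i = l then -1 else 0) * cf (ω l) k := by
      intro l
      have h := hA2 i l
      have h' : (∑ j, (A0 i j : ℂ) * A0 j l) = (if i = l then -1 else 0) := by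
        rw [show (if i = l then -1 else 0 : ℂ) = ((if i = l then -1 else 0 : ℝ) : ℂ) by split_ifs <;> simp, ← h]
        push_cast; rfl
      rw [← h', Finset.sum_mul]
      refine Finset.sum_congr rfl fun j _ => by ring
    simp only [this]
    simp
  have e2 : ∑ x, (A0 i x : ℂ) * (2 * Real.pi * I * (k 0) * ((k 1) / s * cf (ω x) k + (k 0) / s * ∑ j, A0 x j * cf (ω j) k))
      = 2 * Real.pi * I * (k 0) * ((k 1) / s * ∑ x, (A0 i x : ℂ) * cf (ω x) k + (k 0) / s * (- cf (ω i) k)) := by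
    rw [← hAA, Finset.mul_sum, Finset.mul_sum, ← Finset.sum_add_distrib, Finset.mul_sum]
    refine Finset.sum_congr rfl fun x _ => by ring
  rw [e2]
  by_cases hk : k = 0
  · simp [hk]
  have hs0 : s ≠ 0 := by
    rw [hs]
    refine mul_ne_zero (by simp [Real.pi_ne_zero]) ?_
    have : (k 0) ^ 2 + (k 1) ^ 2 ≠ 0 := by
      intro h
      apply hk
      have h0 : k 0 = 0 := by nlinarith [sq_nonneg (k 0), sq_nonneg (k 1)]
      have h1 : k 1 = 0 := by nlinarith [sq_nonneg (k 0), sq_nonneg (k 1)]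
      ext j; fin_cases j <;> simp [h0, h1]
    exact_mod_cast this
  simp only [hk, if_false, mul_zero, sub_zero]
  field_simp
  rw [hs]; ring

end Hopf

namespace Hopf

lemma Lip1Bd {d : ℕ} (A : Fin d → Fin d → SS d) (R : ℝ) (hR : 0 ≤ R) : ∃ K : ℝ, 0 ≤ K ∧
    ∀ i j, ∀ G1 G2 : Fin d → CT, (∀ l, Bd 2 (G1 l) R) → (∀ l, Bd 2 (G2 l) R) → ∀ D, 0 ≤ D →
    (∀ l, Bd 1 (G1 l - G2 l) D) → Bd 1 (cmp (A i j) G1 - cmp (A i j) G2) (K * D) := by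
  refine exists_common (fun i K => ∀ j, ∀ G1 G2 : Fin d → CT, (∀ l, Bd 2 (G1 l) R) → (∀ l, Bd 2 (G2 l) R) → ∀ D, 0 ≤ D →
    (∀ l, Bd 1 (G1 l - G2 l) D) → Bd 1 (cmp (A i j) G1 - cmp (A i j) G2) (K * D)) (fun i => ?_)
    (fun i C C' h H j G1 G2 h1 h2 D hD h3 => (H j G1 G2 h1 h2 D hD h3).mono (by gcongr))
  refine exists_common (fun j K => ∀ G1 G2 : Fin d → CT, (∀ l, Bd 2 (G1 l) R) → (∀ l, Bd 2 (G2 l) R) → ∀ D, 0 ≤ D →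
    (∀ l, Bd 1 (G1 l - G2 l) D) → Bd 1 (cmp (A i j) G1 - cmp (A i j) G2) (K * D)) (fun j => ?_)
    (fun i C C' h H G1 G2 h1 h2 D hD h3 => (H G1 G2 h1 h2 D hD h3).mono (by gcongr))
  obtain ⟨C, hC, h⟩ := Lip1 (A i j) R hR
  refine ⟨C * d, by positivity, fun G1 G2 h1 h2 D hD h3 => ⟨by positivity, ?_⟩⟩
  refine (h G1 G2 (fun l => (h1 l).2) (fun l => (h2 l).2)).trans ?_
  calc _ ≤ ENNReal.ofReal C * ∑ l : Fin d, ENNReal.ofReal D := by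
        gcongr with l; exact (h3 l).2
    _ = _ := by
      rw [Finset.sum_const, Finset.card_univ, Fintype.card_fin, nsmul_eq_mul, mul_assoc, ENNReal.ofReal_mul hC,
        ENNReal.ofReal_mul (by positivity), ENNReal.ofReal_natCast]

lemma exists_sup {d : ℕ} (A : Fin d → Fin d → SS d) : ∃ a : ℝ, 0 ≤ a ∧ ∀ i j x, |(A i j).1 x| ≤ a := by
  refine exists_common (fun i a => ∀ j x, |(A i j).1 x| ≤ a) (fun i => ?_)
    (fun i C C' h H j x => (H j x).trans h)
  refine exists_common (fun j a => ∀ x, |(A i j).1 x| ≤ a) (fun j => ?_)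
    (fun i C C' h H x => (H x).trans h)
  obtain ⟨C, h0, h, -⟩ := (A i j).bd
  exact ⟨C, h0, h⟩

/-- the unknown map -/
noncomputable def Qm {d : ℕ} (ηx ηy : CT) (A0 : Fin d → Fin d → ℝ) (v : Fin d → ℝ) (ω : Fin d → CT) (i : Fin d) : CT :=
  (v i : ℂ) • ηx + ((∑ j, A0 i j * v j : ℝ) : ℂ) • ηy + Tm A0 ω i + cf (ω i) 0 • ηy

/-- the map into the target -/
noncomputable def Gm {d : ℕ} (p : Fin d → ℝ) (ε : ℝ) (q : Fin d → CT) (i : Fin d) : CT :=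
  ContinuousMap.const Tor (p i : ℂ) + (ε : ℂ) • (q i - ContinuousMap.const Tor (q i (pt 0)))

lemma sum_le_da {d : ℕ} {A0 : Fin d → Fin d → ℝ} {a : ℝ} (hA : ∀ i j, |A0 i j| ≤ a) (v : Fin d → ℝ)
    (hv : ‖v‖ ≤ 1) (i : Fin d) : |∑ j, A0 i j * v j| ≤ d * a := by
  refine (Finset.abs_sum_le_sum_abs _ _).trans ?_
  calc _ ≤ ∑ j : Fin d, a := by
        refine Finset.sum_le_sum fun j _ => ?_
        rw [abs_mul]
        have h1 : |v j| ≤ 1 := (norm_le_pi_norm v j).trans hv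
        have h0 := (abs_nonneg _).trans (hA i j)
        calc _ ≤ a * 1 := by gcongr; exact hA i j
          _ = a := mul_one a
    _ = _ := by simp

lemma cf_bd {s : ℕ} {f : CT} {D : ℝ} (h : Bd s f D) (k : Fq) : ‖cf f k‖ ≤ D := (norm_cf_le f k).trans h.norm_le

lemma Qm_bd {d : ℕ} {ηx ηy : CT} {H a : ℝ} (hx : Bd 2 ηx H) (hy : Bd 2 ηy H) {A0 : Fin d → Fin d → ℝ}
    (hA : ∀ i j, |A0 i j| ≤ a) {v : Fin d → ℝ} (hv : ‖v‖ ≤ 1) {ω : Fin d → CT} {D : ℝ}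
    (hω : ∀ l, Bd 1 (ω l) D) (i : Fin d) :
    Bd 2 (Qm ηx ηy A0 v ω i) (H + d * a * H + (1 + d * a) * D + D * H) := by
  have hH := hx.1
  unfold Qm
  refine (((Bd.mono (hx.smul _) ?_).add (Bd.mono (hy.smul _) ?_)).add (Tm_bd hA hω i)).add (Bd.mono (hy.smul _) ?_)
  · rw [Complex.norm_real]
    exact mul_le_of_le_one_left hH ((norm_le_pi_norm v i).trans hv)
  · rw [Complex.norm_real]
    exact mul_le_mul_of_nonneg_right (sum_le_da hA v hv i) hH
  · exact mul_le_mul_of_nonneg_right (cf_bd (hω i) 0) hH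

lemma Qm_sub_bd {d : ℕ} {ηx ηy : CT} {H a : ℝ} (hx : Bd 2 ηx H) (hy : Bd 2 ηy H) {A0 : Fin d → Fin d → ℝ}
    (hA : ∀ i j, |A0 i j| ≤ a) {v : Fin d → ℝ} {ω ω' : Fin d → CT} {D E E' : ℝ}
    (h1 : ∀ l, Bd 1 (ω l) E) (h2 : ∀ l, Bd 1 (ω' l) E')
    (hω : ∀ l, Bd 1 (ω l - ω' l) D) (i : Fin d) :
    Bd 2 (Qm ηx ηy A0 v ω i - Qm ηx ηy A0 v ω' i) ((1 + d * a + H) * D) := by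
  have hH := hx.1
  have e : Qm ηx ηy A0 v ω i - Qm ηx ηy A0 v ω' i = Tm A0 (fun l => ω l - ω' l) i + cf (ω i - ω' i) 0 • ηy := by
    unfold Qm
    rw [Tm_sub h1 h2, cf_sub]
    ext x
    simp
    ring
  rw [e]
  refine ((Tm_bd hA hω i).add (Bd.mono (hy.smul _) (?_ : _ ≤ D * H))).mono (le_of_eq (by ring))
  exact mul_le_mul_of_nonneg_right (cf_bd (hω i) 0) hH

lemma Dx_Qm {d : ℕ} {ηx ηy : CT} {H a : ℝ} (hx : Bd 2 ηx H) (hy : Bd 2 ηy H) {A0 : Fin d → Fin d → ℝ}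
    (hA : ∀ i j, |A0 i j| ≤ a) {v : Fin d → ℝ} {ω : Fin d → CT} {D : ℝ}
    (hω : ∀ l, Bd 1 (ω l) D) (i : Fin d) (j : Fin 2) :
    Dx j (Qm ηx ηy A0 v ω i) = (v i : ℂ) • Dx j ηx + ((∑ j, A0 i j * v j : ℝ) : ℂ) • Dx j ηy + Dx j (Tm A0 ω i)
      + cf (ω i) 0 • Dx j ηy := by
  have hx1 : Bd 1 ηx H := hx.le (by norm_num)
  have hy1 : Bd 1 ηy H := hy.le (by norm_num)
  have hT : Bd 1 (Tm A0 ω i) _ := (Tm_bd hA hω i).le (by norm_num)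
  unfold Qm
  rw [Dx_add (((hx1.smul _).add (hy1.smul _)).add hT) (hy1.smul _), Dx_add ((hx1.smul _).add (hy1.smul _)) hT,
    Dx_add (hx1.smul _) (hy1.smul _), Dx_smul hx1, Dx_smul hy1, Dx_smul hy1]

lemma Bd.centre {q : CT} {C : ℝ} {s : ℕ} (h : Bd s q C) : Bd s (q - ContinuousMap.const Tor (q (pt 0))) (2 * C) :=
  (h.sub (Bd.const s _ ((q.norm_coe_le_norm _).trans h.norm_le))).mono (by linarith)

lemma Gm_bd {d : ℕ} {p : Fin d → ℝ} {R0 ε C : ℝ} (hp : ‖p‖ ≤ R0) (hε : 0 ≤ ε) (hε1 : ε ≤ 1) {q : Fin d → CT}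
    (hq : ∀ i, Bd 2 (q i) C) (i : Fin d) : Bd 2 (Gm p ε q i) (R0 + 2 * C) := by
  have hC := (hq i).1
  unfold Gm
  refine (Bd.const 2 _ ?_).add (((hq i).centre.smul _).mono ?_)
  · rw [Complex.norm_real]; exact (norm_le_pi_norm p i).trans hp
  · rw [Complex.norm_real, Real.norm_of_nonneg hε]
    exact mul_le_of_le_one_left (by positivity) hε1

lemma Gm_sub_bd {d : ℕ} {p : Fin d → ℝ} {ε C : ℝ} (hε : 0 ≤ ε) {q q' : Fin d → CT}
    (hq : ∀ i, Bd 2 (q i - q' i) C) (i : Fin d) : Bd 1 (Gm p ε q i - Gm p ε q' i) (ε * (2 * C)) := by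
  have e : Gm p ε q i - Gm p ε q' i = (ε : ℂ) • ((q i - q' i) - ContinuousMap.const Tor ((q i - q' i) (pt 0))) := by
    ext x; simp [Gm]; ring
  rw [e]
  refine (((hq i).centre.smul _).mono ?_).le (by norm_num)
  rw [Complex.norm_real, Real.norm_of_nonneg hε]

lemma Gm_sub_p {d : ℕ} {p : Fin d → ℝ} {ε C : ℝ} (hε : 0 ≤ ε) {q : Fin d → CT}
    (hq : ∀ i, Bd 2 (q i) C) (i : Fin d) : Bd 1 (Gm p ε q i - ContinuousMap.const Tor (p i : ℂ)) (ε * (2 * C)) := by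
  have e : Gm p ε q i - ContinuousMap.const Tor (p i : ℂ) = (ε : ℂ) • (q i - ContinuousMap.const Tor (q i (pt 0))) := by
    ext x; simp [Gm]
  rw [e]
  refine (((hq i).centre.smul _).mono ?_).le (by norm_num)
  rw [Complex.norm_real, Real.norm_of_nonneg hε]

/-- fixed point map -/
noncomputable def Ph {d : ℕ} (A : Fin d → Fin d → SS d) (ηx ηy : CT) (p v : Fin d → ℝ) (ε : ℝ)
    (ω : Fin d → CT) (i : Fin d) : CT :=
  ∑ j, (cmp (A i j) (Gm p ε (Qm ηx ηy (fun i j => (A i j).1 p) v ω)) - cmp (A i j) (fun l => ContinuousMap.const Tor (p l : ℂ)))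
    * Dx 0 (Qm ηx ηy (fun i j => (A i j).1 p) v ω j)

lemma exists_omega {d : ℕ} (A : Fin d → Fin d → SS d) (R0 : ℝ) (hR0 : 0 ≤ R0) {ηx ηy : CT} {H : ℝ}
    (hx : Bd 2 ηx H) (hy : Bd 2 ηy H) (δ : ℝ) (hδ : 0 < δ) :
    ∃ ε C : ℝ, 0 < ε ∧ ε ≤ 1 ∧ 0 ≤ C ∧ ∀ p v : Fin d → ℝ, ‖p‖ ≤ R0 → ‖v‖ ≤ 1 → ∃ ω : Fin d → CT,
      (∀ l, Bd 1 (ω l) δ) ∧ (∀ l, Bd 2 (Qm ηx ηy (fun i j => (A i j).1 p) v ω l) C) ∧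
      Ph A ηx ηy p v ε ω = ω := by
  obtain ⟨a, ha0, ha⟩ := exists_sup A
  have hH := hx.1
  set CQ := H + d * a * H + (1 + d * a) * δ + δ * H with hCQ
  set CL := 1 + d * a + H with hCL
  have hCQ0 : 0 ≤ CQ := by positivity
  have hCL0 : 0 ≤ CL := by positivity
  obtain ⟨K, hK0, hK⟩ := Lip1Bd A (R0 + 2 * CQ) (by positivity)
  set K1 := d * (K * (2 * CQ) * (2 * Real.pi * CQ)) with hK1
  set K2 := d * (K * (2 * CL) * (2 * Real.pi * CQ) + K * (2 * CQ) * (2 * Real.pi * CL)) with hK2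
  have hK10 : 0 ≤ K1 := by positivity
  have hK20 : 0 ≤ K2 := by positivity
  obtain ⟨ε, hε0, hε1, hεK1, hεK2⟩ : ∃ ε : ℝ, 0 < ε ∧ ε ≤ 1 ∧ ε * K1 ≤ δ ∧ ε * K2 ≤ 1 / 2 := by
    refine ⟨min 1 (min (δ / (1 + K1)) (1 / (2 * (1 + K2)))), by positivity, min_le_left _ _, ?_, ?_⟩
    · calc _ ≤ δ / (1 + K1) * K1 := by
            gcongr; exact (min_le_right _ _).trans (min_le_left _ _)
        _ ≤ δ := by
            rw [div_mul_eq_mul_div, div_le_iff₀ (by positivity)]; nlinarith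
    · calc _ ≤ 1 / (2 * (1 + K2)) * K2 := by
            gcongr; exact (min_le_right _ _).trans (min_le_right _ _)
        _ ≤ 1 / 2 := by
            rw [div_mul_eq_mul_div, div_le_div_iff₀ (by positivity) (by positivity)]; nlinarith
  refine ⟨ε, CQ, hε0, hε1, hCQ0, fun p v hp hv => ?_⟩
  set A0 : Fin d → Fin d → ℝ := fun i j => (A i j).1 p with hA0
  have hA : ∀ i j, |A0 i j| ≤ a := fun i j => ha i j p
  have hQ : ∀ ω : Fin d → CT, (∀ l, Bd 1 (ω l) δ) → ∀ l, Bd 2 (Qm ηx ηy A0 v ω l) CQ := fun ω hω l =>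
    Qm_bd hx hy hA hv hω l
  have hG : ∀ ω : Fin d → CT, (∀ l, Bd 1 (ω l) δ) → ∀ l, Bd 2 (Gm p ε (Qm ηx ηy A0 v ω) l) (R0 + 2 * CQ) := fun ω hω l =>
    Gm_bd hp hε0.le hε1 (hQ ω hω) l
  have hP : ∀ l, Bd 2 (ContinuousMap.const Tor (p l : ℂ)) (R0 + 2 * CQ) := fun l => Bd.const 2 _ (by
    rw [Complex.norm_real]; exact (norm_le_pi_norm p l).trans (hp.trans (by linarith)))
  have hD : ∀ ω : Fin d → CT, (∀ l, Bd 1 (ω l) δ) → ∀ l, Bd 1 (Dx 0 (Qm ηx ηy A0 v ω l)) (2 * Real.pi * CQ) :=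
    fun ω hω l => (hQ ω hω l).dx 0
  have hF : ∀ ω : Fin d → CT, (∀ l, Bd 1 (ω l) δ) → ∀ i j, Bd 1 (cmp (A i j) (Gm p ε (Qm ηx ηy A0 v ω)) -
      cmp (A i j) (fun l => ContinuousMap.const Tor (p l : ℂ))) (K * (ε * (2 * CQ))) := fun ω hω i j =>
    hK i j _ _ (hG ω hω) hP _ (by positivity) (fun l => Gm_sub_p hε0.le (hQ ω hω) l)
  obtain ⟨ω, hω, hfix⟩ := fixpt (Ph A ηx ηy p v ε) δ hδ.le (fun ω hω i => by
      unfold Ph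
      refine (Bd.sum _ fun j _ => (hF ω hω i j).mul (hD ω hω j)).mono ?_
      refine le_trans (le_of_eq ?_) hεK1
      rw [Finset.sum_const, Finset.card_univ, Fintype.card_fin, nsmul_eq_mul, hK1]; ring) (fun ω ω' hω hω' D hDD i => by
      by_cases hd : d = 0
      · subst hd; exact i.elim0
      have hD0 : 0 ≤ D := (hDD i).1
      have hQQ : ∀ l, Bd 2 (Qm ηx ηy A0 v ω l - Qm ηx ηy A0 v ω' l) (CL * D) := fun l => Qm_sub_bd hx hy hA hω hω' hDD l
      have e : Ph A ηx ηy p v ε ω i - Ph A ηx ηy p v ε ω' i = ∑ j,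
          ((cmp (A i j) (Gm p ε (Qm ηx ηy A0 v ω)) - cmp (A i j) (Gm p ε (Qm ηx ηy A0 v ω'))) * Dx 0 (Qm ηx ηy A0 v ω j)
          + (cmp (A i j) (Gm p ε (Qm ηx ηy A0 v ω')) - cmp (A i j) (fun l => ContinuousMap.const Tor (p l : ℂ))) *
            Dx 0 (Qm ηx ηy A0 v ω j - Qm ηx ηy A0 v ω' j)) := by
        unfold Ph
        rw [← Finset.sum_sub_distrib]
        refine Finset.sum_congr rfl fun j _ => ?_
        rw [Dx_sub ((hQ ω hω j).le (by norm_num)) ((hQ ω' hω' j).le (by norm_num))]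
        ring
      rw [e]
      refine (Bd.sum _ fun j _ => ((hK i j _ _ (hG ω hω) (hG ω' hω') _ (by positivity)
        (fun l => Gm_sub_bd hε0.le hQQ l)).mul (hD ω hω j)).add ((hF ω' hω' i j).mul ((hQQ j).dx 0))).mono ?_
      calc _ = (ε * K2) * D := by
            rw [Finset.sum_const, Finset.card_univ, Fintype.card_fin, nsmul_eq_mul, hK2]; ring
        _ ≤ 1 / 2 * D := by gcongr
        _ = D / 2 := by ring)
  exact ⟨ω, hω, hQ ω hω, hfix⟩

theorem disc {d : ℕ} (A : Fin d → Fin d → SS d) (R0 : ℝ) (hR0 : 0 ≤ R0) (δ : ℝ) (hδ : 0 < δ) :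
    ∃ ε ρ M : ℝ, 0 < ε ∧ 0 < ρ ∧ 0 < M ∧ ∀ p v : Fin d → ℝ, ‖p‖ ≤ R0 → ‖v‖ ≤ 1 →
      (∀ i j, ∑ l, (A i l).1 p * (A l j).1 p = if i = j then -1 else 0) →
      ∃ (g : ℂ → Fin d → ℝ) (g' : ℂ → ℂ →L[ℝ] (Fin d → ℝ)), g 0 = p ∧ (∀ z, HasFDerivAt g (g' z) z) ∧
        (∀ z, ‖z‖ < ρ → ∀ i, g' z I i = ∑ j, (A i j).1 (g z) * g' z 1 j) ∧
        (∀ z, ‖g z - p - g' 0 z‖ ≤ M * ‖z‖ ^ 2) ∧ ‖g' 0‖ ≤ M ∧ ‖g' 0 1 - ε • v‖ ≤ δ * ε := by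
  obtain ⟨ηx, H1, ρ1, hρ1, hx, hx'⟩ := exists_eta' 0
  obtain ⟨ηy, H2, ρ2, hρ2, hy, hy'⟩ := exists_eta' 1
  replace hx := hx.mono (le_max_left H1 H2)
  replace hy := hy.mono (le_max_right H1 H2)
  set H := max H1 H2
  obtain ⟨a, ha0, ha⟩ := exists_sup A
  obtain ⟨ε, C, hε0, hε1, hC0, hmain⟩ := exists_omega A R0 hR0 hx hy (δ / (2 * Real.pi * (1 + d * a))) (by positivity)
  refine ⟨ε, min ρ1 ρ2, 1 + ε * (12 * (2 * Real.pi) ^ 2 * C) + ε * (2 * (2 * Real.pi * C)), hε0, by positivity, by positivity,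
    fun p v hp hv hA2 => ?_⟩
  obtain ⟨ω, hω, hQ, hfix⟩ := hmain p v hp hv
  set A0 : Fin d → Fin d → ℝ := fun i j => (A i j).1 p with hA0
  have hA : ∀ i j, |A0 i j| ≤ a := fun i j => ha i j p
  set q := Qm ηx ηy A0 v ω with hq
  have hgder : ∀ z, HasFDerivAt (fun z i => p i + ε * (q i (pt z) - q i (pt 0)).re)
      (ContinuousLinearMap.pi fun i => ε • (Complex.reCLM.comp (Lx (q i) z))) z := by
    intro z
    rw [hasFDerivAt_pi]
    intro i
    have h1 := ((hasFDerivAt_pt (hQ i) z).sub_const (q i (pt 0)))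
    have h2 := (Complex.reCLM.hasFDerivAt.comp z h1).const_mul ε
    exact h2.const_add (p i)
  have h0min : ∀ z : ℂ, ‖z‖ < min ρ1 ρ2 → ‖z‖ < ρ1 ∧ ‖z‖ < ρ2 := fun z hz =>
    ⟨hz.trans_le (min_le_left _ _), hz.trans_le (min_le_right _ _)⟩
  have hD0 : ∀ z : ℂ, ‖z‖ < min ρ1 ρ2 → ∀ i, Dx 0 (q i) (pt z) = v i + Dx 0 (Tm A0 ω i) (pt z) := by
    intro z hz i
    rw [hq, Dx_Qm hx hy hA hω]
    simp [hx' z (h0min z hz).1 0, hy' z (h0min z hz).2 0]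
  have hD1 : ∀ z : ℂ, ‖z‖ < min ρ1 ρ2 → ∀ i, Dx 1 (q i) (pt z) = (∑ j, A0 i j * v j : ℝ) + Dx 1 (Tm A0 ω i) (pt z) + cf (ω i) 0 := by
    intro z hz i
    rw [hq, Dx_Qm hx hy hA hω]
    simp [hx' z (h0min z hz).1 1, hy' z (h0min z hz).2 1]
  refine ⟨fun z i => p i + ε * (q i (pt z) - q i (pt 0)).re,
    fun z => ContinuousLinearMap.pi fun i => ε • (Complex.reCLM.comp (Lx (q i) z)), ?_, hgder, ?_, ?_, ?_, ?_⟩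
  · ext i; simp
  · intro z hz i
    have hrv : rv (Gm p ε q) (pt z) = fun i => p i + ε * (q i (pt z) - q i (pt 0)).re := by
      ext i; simp [rv, Gm]
    set gz : Fin d → ℝ := fun i => p i + ε * (q i (pt z) - q i (pt 0)).re with hgz
    have h1 : ω i (pt z) = ∑ j, (((A i j).1 gz - (A i j).1 p : ℝ) : ℂ) * Dx 0 (q j) (pt z) := by
      have := congrFun hfix i
      rw [← this]
      unfold Ph
      rw [ContinuousMap.sum_apply]
      refine Finset.sum_congr rfl fun j _ => ?_
      rw [ContinuousMap.mul_apply, ContinuousMap.sub_apply, cmp_apply, cmp_apply]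
      rw [← hA0, ← hq, hrv]
      have : rv (fun l => ContinuousMap.const Tor (p l : ℂ)) (pt z) = p := by ext l; simp [rv]
      rw [this]; push_cast; rfl
    have h2 := congrArg (fun f : CT => f (pt z)) (Tm_eq hA2 hω i)
    simp only [ContinuousMap.sub_apply, ContinuousMap.sum_apply, ContinuousMap.smul_apply, ContinuousMap.one_apply,
      smul_eq_mul, mul_one] at h2
    have h3 : Dx 1 (q i) (pt z) = ∑ j, ((A i j).1 gz : ℂ) * Dx 0 (q j) (pt z) := by
      have e1 : ∑ j, (((A i j).1 gz - (A i j).1 p : ℝ) : ℂ) * Dx 0 (q j) (pt z) = ∑ j, ((A i j).1 gz : ℂ) * Dx 0 (q j) (pt z)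
        - ∑ j, (A0 i j : ℂ) * (v j + Dx 0 (Tm A0 ω j) (pt z)) := by
        rw [← Finset.sum_sub_distrib]
        refine Finset.sum_congr rfl fun j _ => ?_
        rw [← hD0 z hz j]; push_cast; ring
      rw [e1] at h1
      simp only [mul_add, Finset.sum_add_distrib] at h1
      rw [hD1 z hz i]
      push_cast
      linear_combination h2 + h1
    simp only [ContinuousLinearMap.pi_apply, ContinuousLinearMap.smul_apply, ContinuousLinearMap.comp_apply, Complex.reCLM_apply,
      Lx_apply, smul_eq_mul]
    simp only [I_re, I_im, one_re, one_im, Complex.ofReal_zero, Complex.ofReal_one, zero_mul, one_mul, zero_add, add_zero]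
    rw [h3, Complex.re_sum, Finset.mul_sum]
    refine Finset.sum_congr rfl fun j _ => ?_
    rw [Complex.re_ofReal_mul]; ring
  · intro z
    rw [pi_norm_le_iff_of_nonneg (by positivity)]
    intro i
    have := quad (hQ i) 0 z
    rw [zero_add, ← Lx_apply] at this
    simp only [Pi.sub_apply, ContinuousLinearMap.pi_apply, ContinuousLinearMap.smul_apply, ContinuousLinearMap.comp_apply, Complex.reCLM_apply,
      smul_eq_mul]
    have e : p i + ε * (q i (pt z) - q i (pt 0)).re - p i - ε * (Lx (q i) 0 z).re = ε * (q i (pt z) - q i (pt 0) - Lx (q i) 0 z).re := by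
      simp; ring
    rw [e, norm_mul, Real.norm_of_nonneg hε0.le]
    calc _ ≤ ε * (12 * (2 * Real.pi) ^ 2 * C * ‖z‖ ^ 2) := by
          gcongr; exact (Complex.abs_re_le_norm _).trans this
      _ = (ε * (12 * (2 * Real.pi) ^ 2 * C)) * ‖z‖ ^ 2 := by ring
      _ ≤ _ := by
          gcongr
          have : 0 ≤ ε * (2 * (2 * Real.pi * C)) := by positivity
          linarith
  · refine ContinuousLinearMap.opNorm_le_bound _ (by positivity) fun z => ?_
    rw [pi_norm_le_iff_of_nonneg (by positivity)]
    intro i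
    simp only [ContinuousLinearMap.pi_apply, ContinuousLinearMap.smul_apply, ContinuousLinearMap.comp_apply, Complex.reCLM_apply,
      smul_eq_mul]
    rw [norm_mul, Real.norm_of_nonneg hε0.le]
    have hb : ∀ j, ‖Dx j (q i) (pt 0)‖ ≤ 2 * Real.pi * C := fun j =>
      ((Dx j (q i)).norm_coe_le_norm _).trans (((hQ i).dx j).norm_le)
    have hL : ‖Lx (q i) 0 z‖ ≤ ‖z‖ * (2 * Real.pi * C) + ‖z‖ * (2 * Real.pi * C) := by
      rw [Lx_apply]
      refine (norm_add_le _ _).trans ?_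
      rw [norm_mul, norm_mul, Complex.norm_real, Complex.norm_real]
      gcongr
      · exact Complex.abs_re_le_norm z
      · exact hb 0
      · exact Complex.abs_im_le_norm z
      · exact hb 1
    calc _ ≤ ε * (‖z‖ * (2 * Real.pi * C) + ‖z‖ * (2 * Real.pi * C)) := by
          gcongr; exact (Complex.abs_re_le_norm _).trans hL
      _ = (ε * (2 * (2 * Real.pi * C))) * ‖z‖ := by ring
      _ ≤ _ := by
          gcongr
          have : 0 ≤ ε * (12 * (2 * Real.pi) ^ 2 * C) := by positivity
          linarith
  · rw [pi_norm_le_iff_of_nonneg (by positivity)]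
    intro i
    simp only [Pi.sub_apply, Pi.smul_apply, ContinuousLinearMap.pi_apply, ContinuousLinearMap.smul_apply, ContinuousLinearMap.comp_apply, Complex.reCLM_apply,
      smul_eq_mul, Lx_apply]
    rw [hD0 0 (by rw [norm_zero]; positivity) i]
    have hb := ((Dx 0 (Tm A0 ω i)).norm_coe_le_norm (pt 0)).trans (((Tm_bd hA hω i).dx 0).norm_le)
    have e : 2 * Real.pi * ((1 + d * a) * (δ / (2 * Real.pi * (1 + d * a)))) = δ := by
      field_simp
    rw [e] at hb
    have e2 : ε * (((1 : ℂ).re : ℂ) * (v i + Dx 0 (Tm A0 ω i) (pt 0)) + ((1 : ℂ).im : ℂ) * Dx 1 (q i) (pt 0)).re - ε * v i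
      = ε * (Dx 0 (Tm A0 ω i) (pt 0)).re := by
      simp; ring
    rw [e2, norm_mul, Real.norm_of_nonneg hε0.le, mul_comm]
    gcongr
    exact (Complex.abs_re_le_norm _).trans hb

end Hopf

namespace Hopf

lemma cutoff {E F : Type*} [NormedAddCommGroup E] [NormedSpace ℝ E] [FiniteDimensional ℝ E]
    [NormedAddCommGroup F] [NormedSpace ℝ F] {k : WithTop ℕ∞} (hk : k ≤ (⊤ : ℕ∞)) {Ω K : Set E} (hΩ : IsOpen Ω)
    (hK : IsCompact K) (hKΩ : K ⊆ Ω) {f : E → F} (hf : ContDiffOn ℝ k f Ω) :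
    ∃ f1 : E → F, ContDiff ℝ k f1 ∧ HasCompactSupport f1 ∧ ∃ δ : ℝ, 0 < δ ∧ ∀ p ∈ K, ∀ y, ‖y - p‖ < δ → y ∈ Ω ∧ f1 y = f y := by
  obtain ⟨K', hK', h1, h2⟩ := exists_compact_between hK hΩ hKΩ
  obtain ⟨χ, hχ1, hχ0, -⟩ := exists_contMDiffMap_one_nhds_of_subset_interior (modelWithCornersSelf ℝ E) (n := (⊤ : ℕ∞))
    hK.isClosed h1
  have hχs : ContDiff ℝ (⊤ : ℕ∞) (χ : E → ℝ) := χ.contMDiff.contDiff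
  have hsupp : ∀ x ∉ K', χ x • f x = 0 := fun x hx => by rw [hχ0 x hx, zero_smul]
  refine ⟨fun x => χ x • f x, ?_, ?_, ?_⟩
  · rw [contDiff_iff_contDiffAt]
    intro x
    by_cases hx : x ∈ Ω
    · exact ((hχs.of_le hk).contDiffAt).smul (hf.contDiffAt (hΩ.mem_nhds hx))
    · have : (fun x => χ x • f x) =ᶠ[𝓝 x] fun _ => 0 := by
        filter_upwards [hK'.isClosed.isOpen_compl.mem_nhds (fun h => hx (h2 h))] with y hy using hsupp y hy
      exact contDiffAt_const.congr_of_eventuallyEq this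
  · exact HasCompactSupport.intro hK' hsupp
  · rw [eventually_nhdsSet_iff_exists] at hχ1
    obtain ⟨U, hU, hKU, hU1⟩ := hχ1
    obtain ⟨δ, hδ, h3⟩ := hK.exists_thickening_subset_open (hU.inter hΩ) (subset_inter hKU hKΩ)
    refine ⟨δ, hδ, fun p hp y hy => ?_⟩
    have := h3 (mem_thickening_iff.2 ⟨p, hp, by rwa [dist_eq_norm]⟩)
    exact ⟨this.2, by simp [hU1 y this.1]⟩

lemma taylor_near {E : Type*} [NormedAddCommGroup E] [NormedSpace ℝ E] [FiniteDimensional ℝ E]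
    {Ω K : Set E} (hΩ : IsOpen Ω)
    (hK : IsCompact K) (hKΩ : K ⊆ Ω) {r : E → ℝ} (hr : ContDiffOn ℝ 2 r Ω) :
    ∃ δ C : ℝ, 0 < δ ∧ 0 < C ∧ ∀ p ∈ K, ∀ y, ‖y - p‖ < δ → y ∈ Ω ∧ |r y - r p - fderiv ℝ r p (y - p)| ≤ C * ‖y - p‖ ^ 2 := by
  obtain ⟨f, hf, hfs, δ, hδ, h⟩ := cutoff (k := 2) (WithTop.coe_le_coe.2 (le_top : (2 : ℕ∞) ≤ ⊤)) hΩ hK hKΩ hr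
  have hf' : ContDiff ℝ 1 (fderiv ℝ f) := hf.fderiv_right (by norm_num)
  obtain ⟨C, hC⟩ := ContDiff.lipschitzWith_of_hasCompactSupport (hfs.fderiv ℝ) hf' one_ne_zero
  refine ⟨δ, C + 1, hδ, by positivity, fun p hp y hy => ⟨(h p hp y hy).1, ?_⟩⟩
  have e : fderiv ℝ r p = fderiv ℝ f p := by
    apply Filter.EventuallyEq.fderiv_eq
    filter_upwards [Metric.ball_mem_nhds p hδ] with x hx
    exact ((h p hp x (by rwa [← dist_eq_norm])).2).symm
  rw [e, ← (h p hp y hy).2, ← (h p hp p (by simpa using hδ)).2]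
  refine (taylor2 f (hf.differentiable (by norm_num)) C C.2 (fun x y => hC.norm_sub_le x y) p y).trans ?_
  gcongr; simp

lemma disc_E {E : Type*} [NormedAddCommGroup E] [NormedSpace ℝ E] [FiniteDimensional ℝ E]
    {Ω K : Set E} (hΩ : IsOpen Ω) (hK : IsCompact K) (hKΩ : K ⊆ Ω) {J : E → E →L[ℝ] E}
    (hJ : ContDiffOn ℝ (⊤ : ℕ∞) J Ω) (hJ2 : ∀ x ∈ Ω, (J x).comp (J x) = -ContinuousLinearMap.id ℝ E)
    (δ : ℝ) (hδ : 0 < δ) :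
    ∃ ε ρ M : ℝ, 0 < ε ∧ 0 < ρ ∧ 0 < M ∧ ∀ p ∈ K, ∀ v : E, ‖v‖ ≤ 1 →
      ∃ (g : ℂ → E) (g' : ℂ → ℂ →L[ℝ] E), g 0 = p ∧ (∀ z, HasFDerivAt g (g' z) z) ∧
        (∀ z, ‖z‖ < ρ → g' z I = J (g z) (g' z 1)) ∧
        (∀ z, ‖g z - p - g' 0 z‖ ≤ M * ‖z‖ ^ 2) ∧ ‖g' 0‖ ≤ M ∧ ‖g' 0 1 - ε • v‖ ≤ δ * ε := by
  obtain ⟨J1, hJ1, hJ1s, δ1, hδ1, hnear⟩ := cutoff le_rfl hΩ hK hKΩ hJ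
  let d := Module.finrank ℝ E
  obtain ⟨e⟩ : Nonempty (E ≃L[ℝ] (Fin d → ℝ)) := FiniteDimensional.nonempty_continuousLinearEquiv_of_finrank_eq (by simp [d])
  set a := ‖(e : E →L[ℝ] (Fin d → ℝ))‖ + 1 with ha
  set b := ‖(e.symm : (Fin d → ℝ) →L[ℝ] E)‖ + 1 with hb
  have ha0 : 0 < a := by positivity
  have hb0 : 0 < b := by positivity
  have hea : ∀ x, ‖e x‖ ≤ a * ‖x‖ := fun x => ((e : E →L[ℝ] (Fin d → ℝ)).le_opNorm x).trans (by gcongr; simp [ha])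
  have heb : ∀ x, ‖e.symm x‖ ≤ b * ‖x‖ := fun x => ((e.symm : (Fin d → ℝ) →L[ℝ] E).le_opNorm x).trans (by gcongr; simp [hb])
  let A : Fin d → Fin d → SS d := fun i j => ⟨fun y => e (J1 (e.symm y) (e.symm (Pi.single j 1))) i, by
    constructor
    · have h1 : ContDiff ℝ (⊤ : ℕ∞) fun y => J1 (e.symm y) := hJ1.comp e.symm.contDiff
      have h2 : ContDiff ℝ (⊤ : ℕ∞) fun y => e (J1 (e.symm y) (e.symm (Pi.single j 1))) :=
        e.contDiff.comp (h1.clm_apply contDiff_const)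
      exact contDiff_pi.1 h2 i
    · have h1 : HasCompactSupport fun y => J1 (e.symm y) := hJ1s.comp_homeomorph e.symm.toHomeomorph
      exact h1.comp_left (g := fun T : E →L[ℝ] E => e (T (e.symm (Pi.single j 1))) i) (by simp)⟩
  have hA : ∀ (x w : E) i, e (J1 x w) i = ∑ j, (A i j).1 (e x) * e w j := by
    intro x w i
    have h1 : w = ∑ j, e w j • e.symm (Pi.single j 1) := by
      apply e.injective
      rw [map_sum]
      simp only [map_smul, e.apply_symm_apply]
      exact pi_eq_sum_univ' (e w)
    conv_lhs => rw [h1]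
    simp only [map_sum, map_smul, Finset.sum_apply, Pi.smul_apply, smul_eq_mul, A, e.symm_apply_apply]
    exact Finset.sum_congr rfl fun j _ => mul_comm _ _
  obtain ⟨R0, hR0⟩ := (hK.image e.continuous).isBounded.exists_norm_le
  obtain ⟨ε, ρ, M, hε, hρ, hM, hmain⟩ := disc A (max R0 0) (le_max_right _ _) (δ / (a * b)) (by positivity)
  refine ⟨ε / a, min (min ρ 1) (δ1 / (4 * (b * M))), b * M, by positivity, by positivity, by positivity, fun p hp v hv => ?_⟩
  obtain ⟨g, g', hg0, hgd, hgJ, hgq, hgM, hgε⟩ := hmain (e p) (a⁻¹ • e v) ((hR0 _ ⟨p, hp, rfl⟩).trans (le_max_left _ _))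
    (by
      rw [norm_smul, norm_inv, Real.norm_of_nonneg ha0.le, inv_mul_le_iff₀ ha0]
      exact (hea v).trans (by gcongr))
    (by
      intro i j
      have h1 := (hnear p hp p (by simpa using hδ1))
      have h2 := hA p (J1 p (e.symm (Pi.single j 1))) i
      have h3 : J1 p (J1 p (e.symm (Pi.single j 1))) = - e.symm (Pi.single j 1) := by
        rw [h1.2]; exact DFunLike.congr_fun (hJ2 p h1.1) _
      rw [h3] at h2
      have h4 : ∀ l, (A l j).1 (e p) = e (J1 p (e.symm (Pi.single j 1))) l := fun l => by simp [A]
      simp only [h4]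
      rw [← h2]
      simp [Pi.single_apply]
      split_ifs <;> simp)
  have hq : ∀ z, ‖e.symm (g z) - p - e.symm (g' 0 z)‖ ≤ b * M * ‖z‖ ^ 2 := fun z => by
    have : e.symm (g z) - p - e.symm (g' 0 z) = e.symm (g z - e p - g' 0 z) := by simp
    rw [this, mul_assoc]
    exact (heb _).trans (by gcongr; exact hgq z)
  have h0 : ∀ z, ‖e.symm (g' 0 z)‖ ≤ b * M * ‖z‖ := fun z => by
    rw [mul_assoc]
    exact (heb _).trans (by gcongr; exact (g' 0).le_of_opNorm_le hgM z)
  refine ⟨fun z => e.symm (g z), fun z => (e.symm : (Fin d → ℝ) →L[ℝ] E).comp (g' z), by simp [hg0],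
    fun z => e.symm.hasFDerivAt.comp z (hgd z), ?_, hq, ?_, ?_⟩
  · intro z hz
    have hz1 : ‖z‖ < ρ := hz.trans_le ((min_le_left _ _).trans (min_le_left _ _))
    have hz2 : ‖z‖ < 1 := hz.trans_le ((min_le_left _ _).trans (min_le_right _ _))
    have hz3 : ‖z‖ < δ1 / (4 * (b * M)) := hz.trans_le (min_le_right _ _)
    have hn : ‖e.symm (g z) - p‖ < δ1 := by
      have : e.symm (g z) - p = (e.symm (g z) - p - e.symm (g' 0 z)) + e.symm (g' 0 z) := by abel
      rw [this]
      refine (norm_add_le _ _).trans_lt (lt_of_le_of_lt (add_le_add (hq z) (h0 z)) ?_)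
      rw [lt_div_iff₀ (by positivity)] at hz3
      have : ‖z‖ ^ 2 ≤ ‖z‖ := by nlinarith [norm_nonneg z]
      have h5 : b * M * ‖z‖ ^ 2 ≤ b * M * ‖z‖ := by gcongr
      nlinarith [norm_nonneg z]
    rw [← (hnear p hp _ hn).2]
    apply e.injective
    ext i
    rw [hA]
    simp only [ContinuousLinearMap.comp_apply, ContinuousLinearEquiv.coe_coe, e.apply_symm_apply]
    exact hgJ z hz1 i
  · exact ContinuousLinearMap.opNorm_le_bound _ (by positivity) h0
  · have : (e.symm : (Fin d → ℝ) →L[ℝ] E) (g' 0 1) - (ε / a) • v = e.symm (g' 0 1 - ε • (a⁻¹ • e v)) := by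
      simp [smul_smul, div_eq_mul_inv]
    rw [ContinuousLinearMap.comp_apply, this]
    refine (heb _).trans ((mul_le_mul_of_nonneg_left hgε hb0.le).trans (le_of_eq ?_))
    field_simp

end Hopf

namespace Hopf

lemma smv {h : ℂ → EReal} (hh : SubharmonicOnE h unitDisc) (hneg : ∀ z ∈ unitDisc, h z ≤ 0)
    {a m : ℝ} (ha0 : 0 < a) (ha1 : a < 1) (hm : 0 < m)
    (hb : ∀ t : ℝ, |t| ≤ (1 - a) / 2 → h (-(a : ℂ) * Complex.exp (t * I)) ≤ ((-m : ℝ) : EReal)) :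
    h 0 ≤ ((-(m * (1 - a) / (2 * Real.pi)) : ℝ) : EReal) := by
  have hsub : closedBall (0 : ℂ) a ⊆ unitDisc := closedBall_subset_ball ha1
  have h1 := hh.2 0 a ha0 hsub
  refine h1.trans ?_
  have hmem : ∀ θ : ℝ, (0 : ℂ) + a * Complex.exp (θ * I) ∈ unitDisc := fun θ => by
    apply hsub
    simp [Complex.norm_exp_ofReal_mul_I, abs_of_pos ha0]
  have hpos : ∀ x : EReal, x ≤ 0 → erealPos x = 0 := by
    intro x hx
    unfold erealPos
    rw [if_neg (by rintro rfl; simp at hx), ENNReal.ofReal_eq_zero]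
    exact EReal.toReal_nonpos hx
  unfold erealIntegral
  have e1 : ∫⁻ θ : ℝ in Ioc (0 : ℝ) (2 * Real.pi), erealPos (h (0 + a * Complex.exp (θ * I))) = 0 := by
    simp only [fun θ : ℝ => hpos _ (hneg _ (hmem θ)), lintegral_zero]
  rw [e1]
  have e2 : ENNReal.ofReal (m * (1 - a)) ≤ ∫⁻ θ : ℝ in Ioc (0 : ℝ) (2 * Real.pi), erealPos (-(h (0 + a * Complex.exp (θ * I)))) := by
    have hpi := Real.pi_gt_three
    have hsub2 : Icc (Real.pi - (1 - a) / 2) (Real.pi + (1 - a) / 2) ⊆ Ioc (0 : ℝ) (2 * Real.pi) := by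
      intro x hx
      constructor <;> linarith [hx.1, hx.2]
    calc ENNReal.ofReal (m * (1 - a)) = ∫⁻ θ : ℝ in Icc (Real.pi - (1 - a) / 2) (Real.pi + (1 - a) / 2), ENNReal.ofReal m := by
          rw [lintegral_const, Measure.restrict_apply_univ, Real.volume_Icc, ENNReal.ofReal_mul hm.le]
          congr 2; ring
      _ ≤ ∫⁻ θ : ℝ in Icc (Real.pi - (1 - a) / 2) (Real.pi + (1 - a) / 2), erealPos (-(h (0 + a * Complex.exp (θ * I)))) := by
          refine setLIntegral_mono' measurableSet_Icc fun θ hθ => ?_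
          have h2 := hb (θ - Real.pi) (abs_le.2 ⟨by linarith [hθ.1], by linarith [hθ.2]⟩)
          have h3 : (0 : ℂ) + a * Complex.exp (θ * I) = -(a : ℂ) * Complex.exp ((θ - Real.pi : ℝ) * I) := by
            push_cast
            rw [sub_mul, Complex.exp_sub, Complex.exp_pi_mul_I]
            ring
          rw [h3]
          have h4 : ((m : ℝ) : EReal) ≤ -h (-(a : ℂ) * Complex.exp ((θ - Real.pi : ℝ) * I)) := by
            rw [EReal.le_neg]; simpa using h2
          unfold erealPos
          split_ifs with h5
          · exact le_top
          · refine ENNReal.ofReal_le_ofReal ?_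
            rw [← EReal.coe_le_coe_iff, EReal.coe_toReal h5]
            · exact h4
            · intro h6; rw [h6] at h4; simp at h4
      _ ≤ _ := lintegral_mono_set hsub2
  set N := ∫⁻ θ : ℝ in Ioc (0 : ℝ) (2 * Real.pi), erealPos (-(h (0 + a * Complex.exp (θ * I))))
  have hc : (0 : ℝ) ≤ (2 * Real.pi)⁻¹ := by positivity
  have hma : 0 ≤ m * (1 - a) := mul_nonneg hm.le (by linarith)
  have e3 : ((0 : ℝ≥0∞) : EReal) - (N : EReal) ≤ ((-(m * (1 - a)) : ℝ) : EReal) := by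
    rw [EReal.coe_ennreal_zero, zero_sub, EReal.coe_neg, EReal.neg_le_neg_iff]
    calc ((m * (1 - a) : ℝ) : EReal) = ((ENNReal.ofReal (m * (1 - a)) : ℝ≥0∞) : EReal) := by
          rw [EReal.coe_ennreal_ofReal, max_eq_left hma]
      _ ≤ _ := EReal.coe_ennreal_le_coe_ennreal_iff.2 e2
  calc _ ≤ (((2 * Real.pi)⁻¹ : ℝ) : EReal) * ((-(m * (1 - a)) : ℝ) : EReal) :=
        mul_le_mul_of_nonneg_left e3 (by exact_mod_cast hc)
    _ = _ := by
        rw [← EReal.coe_mul]; congr 1; field_simp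

lemma mob_lt {a : ℝ} (ha0 : 0 < a) (ha1 : a < 1) {z : ℂ} (hz : ‖z‖ < 1) :
    (1 + a * z ≠ 0) ∧ ‖(z + a) / (1 + a * z)‖ < 1 := by
  have h1 : 1 + a * z ≠ 0 := by
    intro h
    have h2 : ‖(a : ℂ) * z‖ = 1 := by
      rw [show (a : ℂ) * z = -1 by linear_combination h]; simp
    rw [norm_mul, Complex.norm_real, Real.norm_of_nonneg ha0.le] at h2
    nlinarith [norm_nonneg z]
  refine ⟨h1, ?_⟩
  rw [norm_div, div_lt_one (norm_pos_iff.2 h1)]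
  refine lt_of_pow_lt_pow_left₀ 2 (norm_nonneg _) ?_
  have h3 : z.re ^ 2 + z.im ^ 2 < 1 := by
    have := Complex.sq_norm z
    rw [Complex.normSq_apply] at this
    nlinarith [norm_nonneg z]
  rw [Complex.sq_norm, Complex.sq_norm, Complex.normSq_apply, Complex.normSq_apply]
  simp
  nlinarith [mul_pos (sub_pos.2 h3) (show 0 < 1 - a ^ 2 by nlinarith)]

lemma mob_small {a : ℝ} (ha0 : 0 < a) (ha1 : a < 1) {t : ℝ} (ht : |t| ≤ (1 - a) / 2) :
    ‖((-(a : ℂ) * Complex.exp (t * I)) + a) / (1 + a * (-(a : ℂ) * Complex.exp (t * I)))‖ ≤ 1 / 2 := by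
  have h1 : ‖(-(a : ℂ) * Complex.exp (t * I)) + a‖ ≤ a * ((1 - a) / 2) := by
    have : (-(a : ℂ) * Complex.exp (t * I)) + a = -(a : ℂ) * (Complex.exp (I * t) - 1) := by
      rw [mul_comm I]; ring
    rw [this, norm_mul, norm_neg, Complex.norm_real, Real.norm_of_nonneg ha0.le]
    gcongr
    exact Real.norm_exp_I_mul_ofReal_sub_one_le.trans ht
  have h2 : 1 - a ^ 2 ≤ ‖1 + a * (-(a : ℂ) * Complex.exp (t * I))‖ := by
    have : 1 + a * (-(a : ℂ) * Complex.exp (t * I)) = 1 - (a : ℂ) ^ 2 * Complex.exp (t * I) := by ring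
    rw [this]
    have h3 := norm_sub_norm_le (1 : ℂ) ((a : ℂ) ^ 2 * Complex.exp (t * I))
    rw [norm_mul, Complex.norm_exp_ofReal_mul_I, norm_pow, Complex.norm_real, Real.norm_of_nonneg ha0.le] at h3
    simpa using h3
  have h4 : 0 < 1 - a ^ 2 := by nlinarith
  rw [norm_div, div_le_iff₀ (h4.trans_le h2)]
  nlinarith

lemma complete_sq {l : ℂ} (hl : l ≠ 0) {s : ℝ} (hs : 0 < s) (z : ℂ) :
    (l.re * z.re + l.im * z.im) + ‖l‖ / (2 * s) * ‖z‖ ^ 2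
      = ‖l‖ / (2 * s) * (‖z + s * (l / ‖l‖)‖ ^ 2 - s ^ 2) := by
  have hl' : 0 < ‖l‖ := norm_pos_iff.2 hl
  have h1 : ‖l‖ ^ 2 = l.re ^ 2 + l.im ^ 2 := by rw [Complex.sq_norm, Complex.normSq_apply]; ring
  have e : (s : ℂ) * (l / ‖l‖) = ((s / ‖l‖ : ℝ) : ℂ) * l := by push_cast; field_simp
  rw [e, Complex.sq_norm, Complex.sq_norm, Complex.normSq_apply, Complex.normSq_apply]
  simp only [add_re, add_im, Complex.re_ofReal_mul, Complex.im_ofReal_mul]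
  field_simp
  linear_combination (s ^ 2) * h1

lemma disc_est {n : ℕ} {G : Set (Cn n)} {J : Cn n → Cn n →L[ℝ] Cn n} {u : Cn n → EReal}
    (hu : JPshOn J G u) (huneg : ∀ x ∈ G, u x < 0) {g : ℂ → Cn n} {g' : ℂ → ℂ →L[ℝ] Cn n} {ρ s η m : ℝ} {l : ℂ}
    (hg : ∀ z, HasFDerivAt g (g' z) z) (hgJ : ∀ z, ‖z‖ < ρ → g' z I = J (g z) (g' z 1))
    (hJ2 : ∀ x ∈ G, (J x).comp (J x) = -ContinuousLinearMap.id ℝ (Cn n))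
    (hs : 0 < s) (hη : 0 < η) (hm : 0 < m) (hl : l ≠ 0) (hη3 : 2 * η ≤ 3 * ‖l‖ * s) (hρ : 3 * s ≤ ρ)
    (hG : ∀ z, ‖z‖ < ρ → -η + (l.re * z.re + l.im * z.im) + ‖l‖ / (2 * s) * ‖z‖ ^ 2 < 0 → g z ∈ G)
    (hm' : ∀ z, ‖z‖ < ρ → -η + (l.re * z.re + l.im * z.im) + ‖l‖ / (2 * s) * ‖z‖ ^ 2 ≤ - (3 / 8 * ‖l‖ * s) →
      u (g z) ≤ ((-m : ℝ) : EReal)) :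
    u (g 0) ≤ ((-(m / (8 * Real.pi * ‖l‖ * s) * η) : ℝ) : EReal) := by
  have hl' : 0 < ‖l‖ := norm_pos_iff.2 hl
  set R := √(s ^ 2 + 2 * s * η / ‖l‖) with hR
  have hR2 : R ^ 2 = s ^ 2 + 2 * s * η / ‖l‖ := Real.sq_sqrt (by positivity)
  have hRs : s < R := by
    apply Real.lt_sqrt_of_sq_lt
    have : 0 < 2 * s * η / ‖l‖ := by positivity
    linarith
  have hR0 : 0 < R := hs.trans hRs
  have hRs2 : R ≤ 2 * s := by
    refine Real.sqrt_le_iff.2 ⟨by positivity, ?_⟩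
    have : 2 * s * η / ‖l‖ ≤ 3 * s ^ 2 := by
      rw [div_le_iff₀ hl']; nlinarith
    linarith
  have key : ∀ z, -η + (l.re * z.re + l.im * z.im) + ‖l‖ / (2 * s) * ‖z‖ ^ 2
      = ‖l‖ / (2 * s) * (‖z + s * (l / ‖l‖)‖ ^ 2 - R ^ 2) := by
    intro z
    rw [add_assoc, complete_sq hl hs, hR2]
    field_simp; ring
  set a := s / R with ha
  have ha0 : 0 < a := by positivity
  have ha1 : a < 1 := (div_lt_one hR0).2 hRs
  set μ : ℂ := l / ‖l‖ with hμ
  have hμ1 : ‖μ‖ = 1 := by rw [hμ, norm_div, Complex.norm_real, norm_norm, div_self hl'.ne']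
  -- the disc
  set H : ℂ → ℂ := fun ζ => -(s * μ) + R * μ * ((ζ + a) / (1 + a * ζ)) with hH
  have hHn : ∀ ζ, ‖H ζ + s * μ‖ = R * ‖(ζ + a) / (1 + a * ζ)‖ := fun ζ => by
    rw [hH]; simp only
    rw [show -(s * μ) + R * μ * ((ζ + a) / (1 + a * ζ)) + s * μ = R * μ * ((ζ + a) / (1 + a * ζ)) by ring]
    rw [norm_mul, norm_mul, hμ1, Complex.norm_real, Real.norm_of_nonneg hR0.le, mul_one]
  have hHρ : ∀ ζ, ‖ζ‖ < 1 → ‖H ζ‖ < ρ := fun ζ hζ => by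
    have h1 := hHn ζ
    have h2 := (mob_lt ha0 ha1 hζ).2
    have h3 : ‖H ζ‖ ≤ ‖H ζ + s * μ‖ + ‖s * μ‖ := by
      simpa using norm_sub_le (H ζ + s * μ) (s * μ)
    rw [norm_mul, hμ1, Complex.norm_real, Real.norm_of_nonneg hs.le, h1] at h3
    have : R * ‖(ζ + a) / (1 + a * ζ)‖ < R * 1 := by gcongr
    linarith
  have hHG : ∀ ζ, ‖ζ‖ < 1 → g (H ζ) ∈ G := fun ζ hζ => by
    refine hG _ (hHρ ζ hζ) ?_
    rw [key, hHn]
    have h2 := (mob_lt ha0 ha1 hζ).2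
    have h3 : (R * ‖(ζ + a) / (1 + a * ζ)‖) ^ 2 < (R * 1) ^ 2 := by gcongr
    rw [mul_one] at h3
    exact mul_neg_of_pos_of_neg (by positivity) (by linarith)
  have hH0 : H 0 = 0 := by
    simp only [hH, zero_add, mul_zero, add_zero, div_one, ha]
    have : (R : ℂ) ≠ 0 := by exact_mod_cast hR0.ne'
    push_cast; field_simp; ring
  have hdisc : JDisc J G (fun ζ => g (H ζ)) := by
    refine ⟨fun ζ hζ => hHG ζ (by simpa [unitDisc] using hζ), fun ζ hζ => ?_⟩
    have hζ' : ‖ζ‖ < 1 := by simpa [unitDisc] using hζ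
    have hHd : DifferentiableAt ℂ H ζ := by
      have := (mob_lt ha0 ha1 hζ').1
      simp only [hH]
      fun_prop (disch := assumption)
    have h1 : HasFDerivAt H ((fderiv ℂ H ζ).restrictScalars ℝ) ζ := hHd.hasFDerivAt.restrictScalars ℝ
    have h2 : HasFDerivAt (fun ζ => g (H ζ)) ((g' (H ζ)).comp ((fderiv ℂ H ζ).restrictScalars ℝ)) ζ :=
      (hg (H ζ)).comp ζ h1
    refine ⟨h2.differentiableAt, ?_⟩
    rw [h2.fderiv]
    ext1 w
    have hlin : ∀ w : ℂ, g' (H ζ) (I * w) = J (g (H ζ)) (g' (H ζ) w) := by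
      intro w
      have e1 := hgJ (H ζ) (hHρ ζ hζ')
      have e2 : J (g (H ζ)) (J (g (H ζ)) (g' (H ζ) 1)) = - g' (H ζ) 1 :=
        DFunLike.congr_fun (hJ2 _ (hHG ζ hζ')) _
      have e3 : w = w.re • (1 : ℂ) + w.im • I := by
        simp [Complex.re_add_im]
      have e4 : I * w = w.re • I - w.im • (1 : ℂ) := by
        apply Complex.ext <;> simp
      rw [e4]
      conv_rhs => rw [e3]
      simp only [map_sub, map_add, map_smul, e1, e2, smul_neg]
      abel
    simp only [ContinuousLinearMap.comp_apply, ContinuousLinearMap.coe_restrictScalars', JstdC]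
    rw [← hlin]
    simp [mul_assoc]
  have hsh := hu.2 _ hdisc
  have hfin := smv hsh (fun z hz => (huneg _ (hHG z (by simpa [unitDisc] using hz))).le) ha0 ha1 hm (fun t ht => by
    have hζ : ‖-(a : ℂ) * Complex.exp (t * I)‖ < 1 := by
      rw [norm_mul, norm_neg, Complex.norm_real, Complex.norm_exp_ofReal_mul_I, Real.norm_of_nonneg ha0.le, mul_one]
      exact ha1
    refine hm' _ (hHρ _ hζ) ?_
    rw [key, hHn]
    have h3 := mob_small ha0 ha1 ht
    have h4 : (R * ‖((-(a : ℂ) * Complex.exp (t * I)) + a) / (1 + a * (-(a : ℂ) * Complex.exp (t * I)))‖) ^ 2 ≤ (R * (1 / 2)) ^ 2 := by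
      gcongr
    calc _ ≤ ‖l‖ / (2 * s) * ((R * (1 / 2)) ^ 2 - R ^ 2) := by gcongr
      _ = -(‖l‖ / (2 * s) * (3 / 4 * R ^ 2)) := by ring
      _ ≤ -(‖l‖ / (2 * s) * (3 / 4 * s ^ 2)) := by gcongr
      _ = _ := by field_simp; ring)
  simp only [hH0] at hfin
  refine hfin.trans (EReal.coe_le_coe_iff.2 (neg_le_neg ?_))
  have h5 : η / (4 * ‖l‖ * s) ≤ 1 - a := by
    have h6 : (1 - a) * (1 + a) = 2 * s * η / ‖l‖ / R ^ 2 := by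
      rw [ha]; field_simp
      have : ‖l‖ * R ^ 2 = ‖l‖ * s ^ 2 + 2 * s * η := by rw [hR2]; field_simp
      linear_combination this
    have h7 : 2 * s * η / ‖l‖ / (2 * s) ^ 2 ≤ 2 * s * η / ‖l‖ / R ^ 2 := by gcongr
    have h8 : 2 * s * η / ‖l‖ / (2 * s) ^ 2 = 2 * (η / (4 * ‖l‖ * s)) := by field_simp; ring
    nlinarith
  calc m / (8 * Real.pi * ‖l‖ * s) * η = m * (η / (4 * ‖l‖ * s)) / (2 * Real.pi) := by field_simp; ring
    _ ≤ _ := by gcongr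

end Hopf

namespace Hopf

lemma ball_sub {E : Type*} [NormedAddCommGroup E] [NormedSpace ℝ E] {G : Set E} (hG : IsOpen G) {p : E} (hp : p ∈ G) :
    ball p (infDist p (frontier G)) ⊆ G := by
  have hd : Disjoint (ball p (infDist p (frontier G))) (frontier G) := disjoint_ball_infDist
  rcases eq_or_lt_of_le (infDist_nonneg (x := p) (s := frontier G)) with h | h
  · rw [← h]; simp
  by_contra hcon
  rw [not_subset] at hcon
  obtain ⟨y, hy, hyG⟩ := hcon
  have hyc : y ∉ closure G := fun hc => Set.disjoint_left.1 hd hy (by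
    rw [hG.frontier_eq]; exact ⟨hc, hyG⟩)
  have hpre : IsPreconnected (ball p (infDist p (frontier G))) := (convex_ball _ _).isPreconnected
  obtain ⟨x, hx, hx1, hx2⟩ := hpre G (closure G)ᶜ hG isClosed_closure.isOpen_compl (by
    intro x hx
    by_cases hxG : x ∈ G
    · exact Or.inl hxG
    · refine Or.inr fun hc => Set.disjoint_left.1 hd hx ?_
      rw [hG.frontier_eq]; exact ⟨hc, hxG⟩) ⟨p, mem_ball_self h, hp⟩ ⟨y, hy, hyc⟩
  exact hx2 (subset_closure hx1)

lemma usc_neg {E : Type*} [TopologicalSpace E] {G K : Set E} {u : E → EReal} (hu : UpperSemicontinuousOn u G)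
    (hneg : ∀ x ∈ G, u x < 0) (hK : IsCompact K) (hKG : K ⊆ G) :
    ∃ m : ℝ, 0 < m ∧ ∀ x ∈ K, u x ≤ ((-m : ℝ) : EReal) := by
  rcases K.eq_empty_or_nonempty with rfl | hne
  · exact ⟨1, one_pos, by simp⟩
  obtain ⟨x0, hx0, hmax⟩ := UpperSemicontinuousOn.exists_isMaxOn hne hK (hu.mono hKG)
  obtain ⟨t, ht1, ht2⟩ := EReal.lt_iff_exists_real_btwn.1 (hneg x0 (hKG hx0))
  refine ⟨-t, by simpa using ht2, fun x hx => ?_⟩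
  rw [neg_neg]
  exact (hmax hx).trans ht1.le

set_option maxHeartbeats 4000000 in
theorem main {n : ℕ} (G : Set (Cn n)) (hGopen : IsOpen G)
    (hGbdd : IsBounded G)
    (Ωr : Set (Cn n)) (hΩr : IsOpen Ωr) (hGΩr : closure G ⊆ Ωr)
    (r : Cn n → ℝ) (hr : ContDiffOn ℝ 2 r Ωr) (hGr : G = {x ∈ Ωr | r x < 0})
    (hdr : ∀ x ∈ frontier G, fderiv ℝ r x ≠ 0)
    (Ω : Set (Cn n)) (hΩ : IsOpen Ω) (hGΩ : closure G ⊆ Ω)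
    (J : Cn n → Cn n →L[ℝ] Cn n) (hJ : IsACS Ω J)
    (u : Cn n → EReal) (hu : JPshOn J G u) (huneg : ∀ x ∈ G, u x < 0) :
    ∃ C : ℝ, 0 < C ∧ ∀ p ∈ G, u p ≤ ((-(C * infDist p (frontier G)) : ℝ) : EReal) := by
  have : FiniteDimensional ℝ (Cn n) := FiniteDimensional.complexToReal (Cn n)
  have hcG : IsCompact (closure G) := hGbdd.isCompact_closure
  have hrc : ContinuousOn r (closure G) := hr.continuousOn.mono hGΩr
  have hdc : ContinuousOn (fun x => ‖fderiv ℝ r x‖) (closure G) :=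
    ((hr.continuousOn_fderiv_of_isOpen hΩr (by norm_num)).norm).mono hGΩr
  have hGneg : ∀ x ∈ G, r x < 0 := fun x hx => by rw [hGr] at hx; exact hx.2
  have hmemG : ∀ x ∈ Ωr, r x < 0 → x ∈ G := fun x hx h => by rw [hGr]; exact ⟨hx, h⟩
  have hneg_mem : ∀ x ∈ closure G, r x < 0 → x ∈ G := fun x hx => hmemG x (hGΩr hx)
  have hfr : ∀ x ∈ frontier G, x ∈ closure G ∧ x ∉ G := fun x hx => by rwa [hGopen.frontier_eq] at hx
  -- an upper bound for the distance
  obtain ⟨B, hB0, hB⟩ : ∃ B : ℝ, 0 < B ∧ ∀ p ∈ G, infDist p (frontier G) ≤ B := by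
    rcases (frontier G).eq_empty_or_nonempty with h | ⟨y, hy⟩
    · exact ⟨1, one_pos, fun p _ => by rw [h, infDist_empty]; exact zero_le_one⟩
    · refine ⟨diam (closure G) + 1, by positivity, fun p hp => ?_⟩
      have := dist_le_diam_of_mem hcG.isBounded (subset_closure hp) (hfr y hy).1
      linarith [infDist_le_dist_of_mem (x := p) hy]
  -- a lower bound on the differential near the frontier
  obtain ⟨c, η0, hc, hη0, hcdr⟩ : ∃ c η0 : ℝ, 0 < c ∧ 0 < η0 ∧ ∀ x ∈ G, -η0 < r x → c ≤ ‖fderiv ℝ r x‖ := by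
    obtain ⟨c, hc, hcf⟩ : ∃ c : ℝ, 0 < c ∧ ∀ x ∈ frontier G, c < ‖fderiv ℝ r x‖ := by
      rcases (frontier G).eq_empty_or_nonempty with h | hne
      · exact ⟨1, one_pos, by simp [h]⟩
      · have hcf : IsCompact (frontier G) := hcG.of_isClosed_subset isClosed_frontier frontier_subset_closure
        obtain ⟨x0, hx0, hmin⟩ := hcf.exists_isMinOn hne (hdc.mono frontier_subset_closure)
        have h0 : 0 < ‖fderiv ℝ r x0‖ := norm_pos_iff.2 (hdr x0 hx0)
        exact ⟨‖fderiv ℝ r x0‖ / 2, by positivity, fun x hx => lt_of_lt_of_le (by linarith) (hmin hx)⟩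
    set K := closure G ∩ (fun x => ‖fderiv ℝ r x‖) ⁻¹' Iic c with hK
    have hKc : IsCompact K := hcG.of_isClosed_subset (hdc.preimage_isClosed_of_isClosed isClosed_closure isClosed_Iic)
      inter_subset_left
    have hKG : K ⊆ G := fun x hx => by
      by_contra h
      have := hcf x (by rw [hGopen.frontier_eq]; exact ⟨hx.1, h⟩)
      exact absurd hx.2 (not_le.2 this)
    rcases K.eq_empty_or_nonempty with h | hne
    · refine ⟨c, 1, hc, one_pos, fun x hx _ => ?_⟩
      by_contra hlt
      have : x ∈ K := ⟨subset_closure hx, (not_le.1 hlt).le⟩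
      rw [h] at this; exact this
    · obtain ⟨x0, hx0, hmax⟩ := hKc.exists_isMaxOn hne (hrc.mono inter_subset_left)
      refine ⟨c, -r x0, hc, by linarith [hGneg x0 (hKG hx0)], fun x hx hlt => ?_⟩
      by_contra hlt2
      have : x ∈ K := ⟨subset_closure hx, (not_le.1 hlt2).le⟩
      have := hmax this
      change r x ≤ r x0 at this
      linarith
  -- an upper bound on the differential
  obtain ⟨D, hD⟩ : ∃ D : ℝ, ∀ x ∈ closure G, ‖fderiv ℝ r x‖ ≤ D := by
    obtain ⟨D, hD⟩ := hcG.exists_bound_of_continuousOn hdc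
    exact ⟨D, fun x hx => by simpa using hD x hx⟩
  replace hD : ∀ x ∈ closure G, ‖fderiv ℝ r x‖ ≤ |D| + 1 := fun x hx => (hD x hx).trans (by linarith [le_abs_self D])
  set D1 := |D| + 1 with hD1
  have hD0 : 0 < D1 := by positivity
  -- sublevel sets
  have hsub : ∀ κ : ℝ, 0 < κ → ∃ m : ℝ, 0 < m ∧ ∀ x ∈ G, r x ≤ -κ → u x ≤ ((-m : ℝ) : EReal) := by
    intro κ hκ
    have hKc : IsCompact (closure G ∩ r ⁻¹' Iic (-κ)) :=
      hcG.of_isClosed_subset (hrc.preimage_isClosed_of_isClosed isClosed_closure isClosed_Iic) inter_subset_left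
    obtain ⟨m, hm, h⟩ := usc_neg hu.1 huneg hKc (fun x hx => hneg_mem x hx.1 (lt_of_le_of_lt hx.2 (by linarith)))
    exact ⟨m, hm, fun x hx hx2 => h x ⟨subset_closure hx, hx2⟩⟩
  obtain ⟨δ, T, hδ, hT, htay⟩ := taylor_near hΩr hcG hGΩr hr
  obtain ⟨ε, ρ, M, hε, hρ, hM, hdisc⟩ := disc_E hΩ hcG hGΩ hJ.1 hJ.2 (1 / 4) (by norm_num)
  -- constants
  set M' := D1 * M + T * (2 * M) ^ 2 with hM'
  have hM'0 : 0 < M' := by positivity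
  set c1 := ε * c / 4 with hc1
  have hc10 : 0 < c1 := by positivity
  set ρ1 := min (min ρ 1) (δ / (2 * M)) with hρ1
  have hρ10 : 0 < ρ1 := by positivity
  set s := min (ρ1 / 3) (c1 / (2 * M')) with hs
  have hs0 : 0 < s := by positivity
  have hsρ : 3 * s ≤ ρ1 := by linarith [min_le_left (ρ1 / 3) (c1 / (2 * M'))]
  have hsM : M' ≤ c1 / (2 * s) := by
    have := min_le_right (ρ1 / 3) (c1 / (2 * M'))
    rw [← hs, le_div_iff₀ (by positivity)] at this
    rw [le_div_iff₀ (by positivity)]; linarith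
  obtain ⟨m, hm, hum⟩ := hsub (3 / 8 * c1 * s) (by positivity)
  set η1 := min η0 (3 / 2 * c1 * s) with hη1
  have hη10 : 0 < η1 := by positivity
  obtain ⟨m0, hm0, hum0⟩ := hsub η1 hη10
  set Λ := 2 * (D1 * M) with hΛ
  have hΛ0 : 0 < Λ := by positivity
  set κ := min (1 / 2) (min (δ / 2) (c / (4 * T)) / B) with hκ
  have hκ0 : 0 < κ := by positivity
  have hκ1 : κ ≤ 1 / 2 := min_le_left _ _
  have hκB : κ * B ≤ min (δ / 2) (c / (4 * T)) := by
    have := min_le_right (1 / 2) (min (δ / 2) (c / (4 * T)) / B)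
    rwa [← hκ, le_div_iff₀ hB0] at this
  have hκδ : κ * B ≤ δ / 2 := hκB.trans (min_le_left _ _)
  have hκT : κ * B * (4 * T) ≤ c := by
    have := hκB.trans (min_le_right _ _)
    rwa [le_div_iff₀ (by positivity)] at this
  set C1 := m / (8 * Real.pi * Λ * s) * (κ * c / 4) with hC1
  have hC10 : 0 < C1 := by positivity
  refine ⟨min C1 (m0 / B), by positivity, fun p hp => ?_⟩
  set d := infDist p (frontier G) with hd
  have hd0 : 0 ≤ d := infDist_nonneg
  have hdB : d ≤ B := hB p hp
  by_cases hfar : r p ≤ -η1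
  · refine (hum0 p hp hfar).trans (EReal.coe_le_coe_iff.2 (neg_le_neg ?_))
    calc min C1 (m0 / B) * d ≤ m0 / B * B := by
          gcongr; exact min_le_right _ _
      _ = m0 := by field_simp
  rw [not_le] at hfar
  have hpc : p ∈ closure G := subset_closure hp
  set η := - r p with hη
  have hηpos : 0 < η := by rw [hη]; linarith [hGneg p hp]
  have hηη1 : η < η1 := by rw [hη]; linarith
  have hcp : c ≤ ‖fderiv ℝ r p‖ := hcdr p hp (by linarith [min_le_left η0 (3 / 2 * c1 * s)])
  obtain ⟨v, hv1, hv2⟩ : ∃ v : Cn n, ‖v‖ ≤ 1 ∧ ‖fderiv ℝ r p‖ / 2 ≤ fderiv ℝ r p v := by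
    obtain ⟨v, hv1, hv2⟩ := ContinuousLinearMap.exists_lt_apply_of_lt_opNorm (fderiv ℝ r p) (r := ‖fderiv ℝ r p‖ / 2) (by linarith)
    rcases le_abs.1 hv2.le with h | h
    · exact ⟨v, hv1.le, h⟩
    · exact ⟨-v, by simpa using hv1.le, by simpa using h⟩
  -- distance estimate
  have hdist : κ * c / 4 * d ≤ η := by
    rcases eq_or_lt_of_le hd0 with h0 | hdpos
    · rw [← h0, mul_zero]; exact hηpos.le
    set t := κ * d with ht
    have ht0 : 0 < t := by positivity
    have htB : t ≤ κ * B := by rw [ht]; gcongr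
    have hn : ‖(p + t • v) - p‖ ≤ t := by
      rw [add_sub_cancel_left, norm_smul, Real.norm_of_nonneg ht0.le]
      exact mul_le_of_le_one_right ht0.le hv1
    have hyG : p + t • v ∈ G := by
      apply ball_sub hGopen hp
      rw [mem_ball, dist_eq_norm]
      refine hn.trans_lt ?_
      rw [ht]; nlinarith
    have h1 := (htay p hpc (p + t • v) (by linarith)).2
    have h2 := hGneg _ hyG
    have h3 : T * ‖(p + t • v) - p‖ ^ 2 ≤ T * t ^ 2 := by gcongr
    have h4 : fderiv ℝ r p ((p + t • v) - p) = t * fderiv ℝ r p v := by simp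
    rw [h4] at h1
    have h5 := (abs_le.1 (h1.trans h3)).1
    have h6 : t * (c / 2) ≤ t * fderiv ℝ r p v := by gcongr; linarith
    have h7 : T * t ^ 2 ≤ t * (c / 4) := by
      have : t * (4 * T) ≤ c := le_trans (by gcongr) hκT
      nlinarith
    have h8 : κ * c / 4 * d = t * (c / 4) := by rw [ht]; ring
    rw [h8, hη]; linarith
  -- the disc through p
  obtain ⟨g, g', hg0, hgd, hgJ, hgq, hgM, hgv⟩ := hdisc p hpc v hv1
  set L : ℂ →L[ℝ] ℝ := (fderiv ℝ r p).comp (g' 0) with hL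
  set l : ℂ := ⟨L 1, L I⟩ with hl
  have hLz : ∀ z, L z = l.re * z.re + l.im * z.im := by
    intro z
    have : z = z.re • (1 : ℂ) + z.im • I := by simp [Complex.re_add_im]
    conv_lhs => rw [this]
    rw [map_add, map_smul, map_smul, hl]
    simp only [smul_eq_mul]; ring
  have hLn : ∀ z, |L z| ≤ D1 * M * ‖z‖ := fun z => by
    have h1 : ‖L‖ ≤ D1 * M := (ContinuousLinearMap.opNorm_comp_le _ _).trans (by gcongr; exact hD p hpc)
    exact L.le_of_opNorm_le h1 z
  have hlup : ‖l‖ ≤ Λ := by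
    have h1 := Complex.norm_le_abs_re_add_abs_im l
    have h2 := hLn 1
    have h3 := hLn I
    simp only [norm_one, mul_one, Complex.norm_I] at h2 h3
    have e1 : l.re = L 1 := rfl
    have e2 : l.im = L I := rfl
    rw [e1, e2] at h1
    rw [hΛ]; linarith
  have hllow : c1 ≤ ‖l‖ := by
    have h1 : L 1 ≤ ‖l‖ := Complex.re_le_norm l
    have e1 : L 1 = ε * fderiv ℝ r p v + fderiv ℝ r p (g' 0 1 - ε • v) := by
      simp [hL]
    have h2 : |fderiv ℝ r p (g' 0 1 - ε • v)| ≤ ‖fderiv ℝ r p‖ * (1 / 4 * ε) :=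
      ((fderiv ℝ r p).le_opNorm _).trans (by gcongr)
    have h3 := (abs_le.1 h2).1
    have h4 : ε * (‖fderiv ℝ r p‖ / 2) ≤ ε * fderiv ℝ r p v := by gcongr
    have h5 : ε * c ≤ ε * ‖fderiv ℝ r p‖ := by gcongr
    rw [hc1]; linarith
  have hlpos : 0 < ‖l‖ := hc10.trans_le hllow
  have hl0 : l ≠ 0 := norm_pos_iff.1 hlpos
  have hgest : ∀ z, ‖z‖ < ρ1 → g z ∈ Ωr ∧ r (g z) ≤ -η + (l.re * z.re + l.im * z.im) + ‖l‖ / (2 * s) * ‖z‖ ^ 2 := by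
    intro z hz
    have hz1 : ‖z‖ < 1 := hz.trans_le ((min_le_left _ _).trans (min_le_right _ _))
    have hz3 : ‖z‖ < δ / (2 * M) := hz.trans_le (min_le_right _ _)
    rw [lt_div_iff₀ (by positivity)] at hz3
    have hn : ‖g z - p‖ ≤ 2 * M * ‖z‖ := by
      have e : g z - p = (g z - p - g' 0 z) + g' 0 z := by abel
      rw [e]
      refine (norm_add_le _ _).trans ((add_le_add (hgq z) ((g' 0).le_of_opNorm_le hgM z)).trans ?_)
      have : ‖z‖ ^ 2 ≤ ‖z‖ := by nlinarith [norm_nonneg z]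
      have h5 : M * ‖z‖ ^ 2 ≤ M * ‖z‖ := by gcongr
      linarith
    obtain ⟨h1, h2⟩ := htay p hpc (g z) (by linarith)
    refine ⟨h1, ?_⟩
    have h3 := (abs_le.1 h2).2
    have h4 : fderiv ℝ r p (g z - p) = L z + fderiv ℝ r p (g z - p - g' 0 z) := by
      simp [hL]
    have h5 : fderiv ℝ r p (g z - p - g' 0 z) ≤ D1 * (M * ‖z‖ ^ 2) := by
      refine (le_abs_self _).trans (((fderiv ℝ r p).le_of_opNorm_le (hD p hpc) _).trans ?_)
      gcongr; exact hgq z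
    have h6 : T * ‖g z - p‖ ^ 2 ≤ T * (2 * M * ‖z‖) ^ 2 := by gcongr
    have h7 : M' * ‖z‖ ^ 2 ≤ ‖l‖ / (2 * s) * ‖z‖ ^ 2 := by
      gcongr; exact hsM.trans (by gcongr)
    have h8 : M' * ‖z‖ ^ 2 = D1 * (M * ‖z‖ ^ 2) + T * (2 * M * ‖z‖) ^ 2 := by rw [hM']; ring
    rw [← hLz z]
    rw [h4] at h3
    rw [hη]; linarith
  have hfin := disc_est (ρ := ρ1) (s := s) (η := η) (m := m) (l := l) hu huneg hgd
    (fun z hz => hgJ z (hz.trans_le ((min_le_left _ _).trans (min_le_left _ _))))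
    (fun x hx => hJ.2 x (hGΩ (subset_closure hx))) hs0 hηpos hm hl0
    (by
      have h1 : η1 ≤ 3 / 2 * c1 * s := min_le_right _ _
      have h2 : c1 * s ≤ ‖l‖ * s := by gcongr
      linarith) hsρ
    (fun z hz h => hmemG _ (hgest z hz).1 ((hgest z hz).2.trans_lt h))
    (fun z hz h => by
      have h2 : c1 * s ≤ ‖l‖ * s := by gcongr
      have h3 : r (g z) ≤ -(3 / 8 * c1 * s) := by linarith [(hgest z hz).2]
      have h4 : 0 < 3 / 8 * c1 * s := by positivity
      exact hum _ (hmemG _ (hgest z hz).1 (by linarith)) h3)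
  rw [hg0] at hfin
  refine hfin.trans (EReal.coe_le_coe_iff.2 (neg_le_neg ?_))
  calc min C1 (m0 / B) * d ≤ C1 * d := by gcongr; exact min_le_left _ _
    _ = m / (8 * Real.pi * Λ * s) * (κ * c / 4 * d) := by rw [hC1]; ring
    _ ≤ m / (8 * Real.pi * ‖l‖ * s) * η := by gcongr

end Hopf

/-- **Hopf lemma on almost complex manifolds** (Lemma 1.4.7): if `G` is a bounded domain with
`C²` boundary and `u < 0` is `J`-plurisubharmonic on `G`, then `|u(p)| ≥ C dist(p,∂G)`. -/
theorem hopf_lemma {n : ℕ} (G : Set (Cn n)) (hGopen : IsOpen G) (hGconn : IsConnected G)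
    (hGbdd : IsBounded G)
    (Ωr : Set (Cn n)) (hΩr : IsOpen Ωr) (hGΩr : closure G ⊆ Ωr)
    (r : Cn n → ℝ) (hr : ContDiffOn ℝ 2 r Ωr) (hGr : G = {x ∈ Ωr | r x < 0})
    (hdr : ∀ x ∈ frontier G, fderiv ℝ r x ≠ 0)
    (Ω : Set (Cn n)) (hΩ : IsOpen Ω) (hGΩ : closure G ⊆ Ω)
    (J : Cn n → Cn n →L[ℝ] Cn n) (hJ : IsACS Ω J)
    (u : Cn n → EReal) (hu : JPshOn J G u) (huneg : ∀ x ∈ G, u x < 0) :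
    ∃ C : ℝ, 0 < C ∧ ∀ p ∈ G, u p ≤ ((-(C * infDist p (frontier G)) : ℝ) : EReal) := by
  exact Hopf.main G hGopen hGbdd Ωr hΩr hGΩr r hr hGr hdr Ω hΩ hGΩ J hJ u hu huneg
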